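/- Let H be a graph that is 3-connected or isomorphic to K_3, let q ≥ 2 be an integer, and let H' be an arbitrary graph. If every graph that is q-Ramsey-minimal for H is also q-Ramsey-minimal for H' (i.e. M_q(H) ⊆ M_q(H'), up to isomorphism), then M_q(H) = M_q(H'), i.e. a graph is q-Ramsey-minimal for H if and only if it is q-Ramsey-minimal for H'. -/

import Mathlib

open SimpleGraph

/-- The colouring `c` contains a copy of `H` in `G` all of whose edges have colour `i`. -/
def HasMonoCopyColor {V W : Type*} (G : SimpleGraph V) (H : SimpleGraph W) {q : ℕ}
    (c : Sym2 V → Fin q) (i : Fin q) : Prop :=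
  ∃ f : W ↪ V, ∀ a b, H.Adj a b → G.Adj (f a) (f b) ∧ c s(f a, f b) = i

/-- The colouring `c` contains a monochromatic copy of `H` in `G`. -/
def HasMonoCopy {V W : Type*} (G : SimpleGraph V) (H : SimpleGraph W) {q : ℕ}
    (c : Sym2 V → Fin q) : Prop :=
  ∃ i : Fin q, HasMonoCopyColor G H c i

/-- `G` is `q`-Ramsey for `H`: every `q`-colouring of the edges of `G` contains a
monochromatic copy of `H`. -/
def IsRamsey (q : ℕ) {V W : Type*} (G : SimpleGraph V) (H : SimpleGraph W) : Prop :=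
  ∀ c : Sym2 V → Fin q, HasMonoCopy G H c

/-- `G` is `q`-Ramsey-minimal for `H`: `G` is `q`-Ramsey for `H` but no proper
subgraph of `G` is. -/
def IsRamseyMinimal (q : ℕ) {V W : Type*} (G : SimpleGraph V) (H : SimpleGraph W) : Prop :=
  IsRamsey q G H ∧ ∀ G' : G.Subgraph, G' ≠ ⊤ → ¬ IsRamsey q G'.coe H

/-- `H` is 3-connected: it has at least 4 vertices and deleting any set of at most
2 vertices leaves a connected graph. -/
def ThreeConnected {V : Type*} [Fintype V] (H : SimpleGraph V) : Prop :=
  4 ≤ Fintype.card V ∧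
    ∀ S : Finset V, S.card ≤ 2 → (H.induce ((↑S : Set V)ᶜ)).Connected

/-- `H` is 3-connected or isomorphic to `K₃`. -/
def ThreeConnOrK3 {V : Type*} [Fintype V] (H : SimpleGraph V) : Prop :=
  ThreeConnected H ∨ Nonempty (H ≃g (⊤ : SimpleGraph (Fin 3)))

/-- Deleting at most two vertices does not disconnect `H`, which has at least three vertices. -/
def StrongConn {W : Type} [Fintype W] (H : SimpleGraph W) : Prop :=
  3 ≤ Fintype.card W ∧ ∀ S : Finset W, S.card ≤ 2 → ∀ p : W → Prop,
    (∀ a b, a ∉ S → b ∉ S → H.Adj a b → p a → p b) → ∀ a b, a ∉ S → b ∉ S → p a → p b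

theorem ThreeConnOrK3.strongConn {W : Type} [Fintype W] {H : SimpleGraph W}
    (hH : ThreeConnOrK3 H) : StrongConn H := by
  rcases hH with ⟨h4, hc⟩ | ⟨⟨e⟩⟩
  · refine ⟨by omega, fun S hS p hp a b ha hb hpa => ?_⟩
    have hr := (hc S hS).preconnected ⟨a, by simpa using ha⟩ ⟨b, by simpa using hb⟩
    obtain ⟨w⟩ := hr
    have key : ∀ (x y : ((↑S : Set W)ᶜ : Set W)), (H.induce ((↑S : Set W)ᶜ)).Walk x y →
        p x → p y := by
      intro x y w
      induction w with
      | nil => exact id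
      | @cons u v _ huv _ ih =>
        exact fun h => ih (hp u v (fun h => u.2 h) (fun h => v.2 h) huv h)
    exact key _ _ w hpa
  · refine ⟨by rw [Fintype.card_congr e.toEquiv]; simp, fun S _ p hp a b ha hb hpa => ?_⟩
    by_cases hab : a = b
    · exact hab ▸ hpa
    · refine hp a b ha hb ?_ hpa
      rw [← e.map_adj_iff]
      simpa using hab

namespace StrongConn

variable {W : Type} [Fintype W] {H : SimpleGraph W}

theorem exists_adj_ne (hH : StrongConn H) (a b : W) : ∃ c, c ≠ b ∧ H.Adj a c := by
  classical
  by_contra! hcon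
  have hcard : ({a, b} : Finset W).card < Fintype.card W :=
    lt_of_le_of_lt Finset.card_le_two (by have := hH.1; omega)
  obtain ⟨d, hd⟩ := Finset.exists_mem_notMem_of_card_lt_card
    (s := {a, b}) (t := Finset.univ) (by simpa using hcard)
  simp only [Finset.mem_univ, Finset.mem_insert, Finset.mem_singleton, not_or, true_and] at hd
  refine hd.1 (hH.2 (({b} : Finset W).erase a) ?_ (fun x => x = a) ?_ a d (by simp) ?_ rfl)
  · exact (Finset.card_le_card (Finset.erase_subset _ _)).trans (by simp)
  · rintro x y hx hy hxy rfl
    by_cases hyb : y = b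
    · subst hyb
      by_contra hne
      exact hy (by simp [hne])
    · exact absurd hxy (hcon y hyb)
  · simp [hd.2]

theorem exists_adj (hH : StrongConn H) (a : W) : ∃ c, H.Adj a c :=
  let ⟨c, _, h⟩ := hH.exists_adj_ne a a
  ⟨c, h⟩

theorem exists_path (hH : StrongConn H) :
    ∃ a b c d, H.Adj a b ∧ H.Adj a c ∧ H.Adj b d ∧ c ≠ b ∧ d ≠ a := by
  have : Nonempty W := Fintype.card_pos_iff.1 (by have := hH.1; omega)
  obtain ⟨a⟩ := this
  obtain ⟨b, hab⟩ := hH.exists_adj a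
  obtain ⟨c, hc, hac⟩ := hH.exists_adj_ne a b
  obtain ⟨d, hd, hbd⟩ := hH.exists_adj_ne b a
  exact ⟨a, b, c, d, hab, hac, hbd, hc, hd⟩

end StrongConn

/-- The colouring `c` of `G` has no monochromatic copy of `H`. -/
def Good {V W : Type} {q : ℕ} (H : SimpleGraph W) (G : SimpleGraph V) (c : Sym2 V → Fin q) :
    Prop :=
  ¬ HasMonoCopy G H c

theorem not_isRamsey_iff {V W : Type} {q : ℕ} {G : SimpleGraph V} {H : SimpleGraph W} :
    ¬ IsRamsey q G H ↔ ∃ c : Sym2 V → Fin q, Good H G c := by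
  simp [IsRamsey, Good]

namespace Good

variable {V V' W : Type} {q : ℕ} {H : SimpleGraph W}

theorem congr {F G : SimpleGraph V} {c c' : Sym2 V → Fin q} (h : Good H G c)
    (hFG : ∀ u v, F.Adj u v → G.Adj u v)
    (hc : ∀ u v, F.Adj u v → c' s(u, v) = c s(u, v)) : Good H F c' := by
  rintro ⟨i, f, hf⟩
  exact h ⟨i, f, fun a b hab => ⟨hFG _ _ (hf a b hab).1,
    (hc _ _ (hf a b hab).1) ▸ (hf a b hab).2⟩⟩

theorem mono {F G : SimpleGraph V} {c : Sym2 V → Fin q} (h : Good H G c) (hFG : F ≤ G) :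
    Good H F c :=
  h.congr (fun _ _ h => hFG h) fun _ _ _ => rfl

theorem comap {S : SimpleGraph V'} {F : SimpleGraph V} {c : Sym2 V → Fin q} (h : Good H F c)
    {j : V' → V} (hj : j.Injective) (hS : ∀ u v, S.Adj u v → F.Adj (j u) (j v)) :
    Good H S fun e => c (e.map j) := by
  rintro ⟨i, f, hf⟩
  exact h ⟨i, f.trans ⟨j, hj⟩,
    fun a b hab => ⟨hS _ _ (hf a b hab).1, by simpa using (hf a b hab).2⟩⟩

theorem map [Fintype W] (hH : StrongConn H) {S : SimpleGraph V'} {c : Sym2 V' → Fin q}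
    (h : Good H S c) {j : V' → V} (hj : j.Injective) {c' : Sym2 V → Fin q}
    (hc : ∀ u v, S.Adj u v → c' s(j u, j v) = c s(u, v)) : Good H (S.map j) c' := by
  rintro ⟨i, f, hf⟩
  have hr : ∀ a, ∃ u, j u = f a := by
    intro a
    obtain ⟨b, hb⟩ := hH.exists_adj a
    have := (hf a b hb).1
    rw [SimpleGraph.map_adj'] at this
    obtain ⟨-, u, v, -, hu, -⟩ := this
    exact ⟨u, hu⟩
  choose g hg using hr
  refine h ⟨i, ⟨g, fun a b hab => f.injective (by rw [← hg, ← hg, hab])⟩, fun a b hab => ?_⟩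
  obtain ⟨h1, h2⟩ := hf a b hab
  rw [SimpleGraph.map_adj'] at h1
  obtain ⟨-, u, v, huv, hu, hv⟩ := h1
  have hua : u = g a := hj (hu.trans (hg a).symm)
  have hvb : v = g b := hj (hv.trans (hg b).symm)
  subst hua hvb
  refine ⟨huv, ?_⟩
  rw [← h2, ← hg, ← hg]
  exact (hc _ _ huv).symm

theorem perm {G : SimpleGraph V} [Fintype W] (hH : StrongConn H) {c : Sym2 V → Fin q}
    (h : Good H G c) {σ : Fin q → Fin q} (hσ : σ.Injective) : Good H G fun e => σ (c e) := by
  rintro ⟨i, f, hf⟩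
  obtain ⟨a, b, _, _, hab, -⟩ := hH.exists_path
  refine h ⟨c s(f a, f b), f, fun x y hxy => ⟨(hf x y hxy).1, hσ ?_⟩⟩
  exact (hf x y hxy).2.trans (hf a b hab).2.symm

end Good

/-- The supports of the relations `P` and `Q` share at most two vertices `u`, `v`, and `uv` is
in both relations or in neither. -/
def SepRel {V : Type} (P Q : V → V → Prop) : Prop :=
  ∃ u v, (∀ w, (∃ z, P w z) → (∃ z, Q w z) → w = u ∨ w = v) ∧ (P u v ↔ Q u v)

theorem StrongConn.all_of_sep {V W : Type} [Fintype W] {H : SimpleGraph W} (hH : StrongConn H)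
    {P Q : V → V → Prop} (hP : ∀ a b, P a b → P b a) (hQ : ∀ a b, Q a b → Q b a) (hPQ : SepRel P Q)
    (f : W ↪ V) (hf : ∀ a b, H.Adj a b → P (f a) (f b) ∨ Q (f a) (f b)) :
    (∀ a b, H.Adj a b → P (f a) (f b)) ∨ (∀ a b, H.Adj a b → Q (f a) (f b)) := by
  classical
  obtain ⟨u, v, hsep, huv⟩ := hPQ
  let S : Finset W := Finset.univ.filter fun a => f a = u ∨ f a = v
  have hmem : ∀ a, a ∈ S ↔ f a = u ∨ f a = v := fun a => by simp [S]
  have hcard : S.card ≤ 2 := by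
    have : S.card ≤ ({u, v} : Finset V).card :=
      Finset.card_le_card_of_injOn f (fun a ha => by simpa using (hmem a).1 ha)
        f.injective.injOn
    exact this.trans Finset.card_le_two
  have hboth : ∀ a b, H.Adj a b → a ∈ S → b ∈ S → (P (f a) (f b) ↔ Q (f a) (f b)) := by
    intro a b hab ha hb
    have hne : f a ≠ f b := fun h => hab.ne (f.injective h)
    rcases (hmem a).1 ha with h1 | h1 <;> rcases (hmem b).1 hb with h2 | h2
    · exact absurd (h1.trans h2.symm) hne
    · rw [h1, h2]; exact huv
    · rw [h1, h2]
      exact ⟨fun h => hQ _ _ (huv.1 (hP _ _ h)), fun h => hP _ _ (huv.2 (hQ _ _ h))⟩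
    · exact absurd (h1.trans h2.symm) hne
  have hone : ∀ a, a ∉ S → (∃ z, P (f a) z) → (∃ z, Q (f a) z) → False :=
    fun a ha h1 h2 => ha ((hmem a).2 (hsep _ h1 h2))
  have hconn := hH.2 S hcard (fun a => ∃ z, P (f a) z) (by
    intro a b ha hb hab hpa
    rcases hf a b hab with h | h
    · exact ⟨_, hP _ _ h⟩
    · exact (hone a ha hpa ⟨_, h⟩).elim)
  by_cases hex : ∃ a, a ∉ S ∧ ∃ z, P (f a) z
  · obtain ⟨a₀, ha₀, hp₀⟩ := hex
    left
    intro a b hab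
    rcases hf a b hab with h | h
    · exact h
    by_cases ha : a ∈ S
    · by_cases hb : b ∈ S
      · exact (hboth a b hab ha hb).2 h
      · exact (hone b hb (hconn a₀ b ha₀ hb hp₀) ⟨_, hQ _ _ h⟩).elim
    · exact (hone a ha (hconn a₀ a ha₀ ha hp₀) ⟨_, h⟩).elim
  · push Not at hex
    right
    intro a b hab
    rcases hf a b hab with h | h
    · by_cases ha : a ∈ S
      · by_cases hb : b ∈ S
        · exact (hboth a b hab ha hb).1 h
        · exact (hex b hb _ (hP _ _ h)).elim
      · exact (hex a ha _ h).elim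
    · exact h

/-- Among any at most `n` of the pieces `P k` that include those indexed by `J₀`, and of which
there are at least two, one outside `J₀` is separated from the union of the others. -/
def LeafFree {V K : Type} (P : K → SimpleGraph V) (J₀ : Finset K) (n : ℕ) : Prop :=
  ∀ J : Finset K, J₀ ⊆ J → J.Nonempty → J.card ≤ n → (∃ k, J = {k}) ∨
    ∃ k ∈ J, k ∉ J₀ ∧ SepRel (P k).Adj (fun a b => ∃ l ∈ J, l ≠ k ∧ (P l).Adj a b)

theorem LeafFree.deleteEdges {V K : Type} {P : K → SimpleGraph V} {J₀ : Finset K} {n : ℕ}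
    (h : LeafFree P J₀ n) (D : Set (Sym2 V)) :
    LeafFree (fun k => (P k).deleteEdges D) J₀ n := by
  intro J hJ hne hn
  refine (h J hJ hne hn).imp id ?_
  rintro ⟨k, hk, hk0, u, v, hs, huv⟩
  refine ⟨k, hk, hk0, u, v, ?_, ?_⟩
  · rintro w ⟨z, hz⟩ ⟨z', l, hl, hlk, hz'⟩
    rw [deleteEdges_adj] at hz hz'
    exact hs w ⟨z, hz.1⟩ ⟨z', l, hl, hlk, hz'.1⟩
  · simp only [deleteEdges_adj]
    rw [huv]
    constructor
    · rintro ⟨⟨l, h1, h2, h3⟩, h4⟩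
      exact ⟨l, h1, h2, h3, h4⟩
    · rintro ⟨l, h1, h2, h3, h4⟩
      exact ⟨⟨l, h1, h2, h3⟩, h4⟩

/-- Every copy of `H` in the union of the pieces lies inside one of them. -/
def NoCross {V W K : Type} (H : SimpleGraph W) (P : K → SimpleGraph V) : Prop :=
  ∀ f : W ↪ V, (∀ a b, H.Adj a b → ∃ k, (P k).Adj (f a) (f b)) →
    ∃ k, ∀ a b, H.Adj a b → (P k).Adj (f a) (f b)

theorem LeafFree.noCross {V W K : Type} [Fintype W] {H : SimpleGraph W} (hH : StrongConn H)
    {P : K → SimpleGraph V} {J₀ : Finset K} (hJ₀ : J₀.card ≤ 1)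
    (h : LeafFree P J₀ (Fintype.card (W × W) + 1)) : NoCross H P := by
  classical
  intro f hf
  obtain ⟨a₀, b₀, _, _, hab₀, -⟩ := hH.exists_path
  have key : ∀ J : Finset K, J₀ ⊆ J → J.card ≤ Fintype.card (W × W) + 1 →
      (∀ a b, H.Adj a b → ∃ k ∈ J, (P k).Adj (f a) (f b)) →
      ∃ k, ∀ a b, H.Adj a b → (P k).Adj (f a) (f b) := by
    intro J
    induction J using Finset.strongInduction with
    | H J ih =>
      intro hJ hn hcov
      have hne : J.Nonempty := let ⟨k, hk, _⟩ := hcov a₀ b₀ hab₀; ⟨k, hk⟩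
      rcases h J hJ hne hn with ⟨k, rfl⟩ | ⟨k, hk, hk0, hs⟩
      · refine ⟨k, fun a b hab => ?_⟩
        obtain ⟨l, hl, hl'⟩ := hcov a b hab
        rwa [Finset.mem_singleton.1 hl] at hl'
      · have := hH.all_of_sep (fun _ _ h => SimpleGraph.Adj.symm h)
          (fun _ _ ⟨l, h1, h2, h3⟩ => ⟨l, h1, h2, h3.symm⟩) hs f (fun a b hab => by
            obtain ⟨l, hl, hl'⟩ := hcov a b hab
            by_cases hlk : l = k
            · exact Or.inl (hlk ▸ hl')
            · exact Or.inr ⟨l, hl, hlk, hl'⟩)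
        rcases this with h1 | h1
        · exact ⟨k, h1⟩
        · refine ih (J.erase k) (Finset.erase_ssubset hk) ?_ ?_ ?_
          · exact fun l hl => Finset.mem_erase.2 ⟨fun h => hk0 (h ▸ hl), hJ hl⟩
          · exact (Finset.card_le_card (Finset.erase_subset _ _)).trans hn
          · intro a b hab
            obtain ⟨l, h2, h3, h4⟩ := h1 a b hab
            exact ⟨l, Finset.mem_erase.2 ⟨h3, h2⟩, h4⟩
  obtain ⟨k₀, -⟩ := hf a₀ b₀ hab₀
  have hch : ∀ x : W × W, ∃ k, H.Adj x.1 x.2 → (P k).Adj (f x.1) (f x.2) := by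
    intro x
    by_cases hx : H.Adj x.1 x.2
    · obtain ⟨k, hk⟩ := hf _ _ hx
      exact ⟨k, fun _ => hk⟩
    · exact ⟨k₀, fun h => (hx h).elim⟩
  choose g hg using hch
  refine key (J₀ ∪ Finset.univ.image g) Finset.subset_union_left ?_ ?_
  · refine (Finset.card_union_le _ _).trans ?_
    have : (Finset.univ.image g).card ≤ Fintype.card (W × W) := Finset.card_image_le
    omega
  · exact fun a b hab => ⟨g (a, b), by simp, hg (a, b) hab⟩

theorem NoCross.exists_good {V W K : Type} {q : ℕ} [NeZero q] {H : SimpleGraph W}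
    {P : K → SimpleGraph V} (hP : NoCross H P) {F : SimpleGraph V}
    (hF : ∀ u v, F.Adj u v → ∃ k, (P k).Adj u v) {c : K → Sym2 V → Fin q}
    (hc : ∀ k, Good H (P k) (c k))
    (hcc : ∀ k l u v, (P k).Adj u v → (P l).Adj u v → c k s(u, v) = c l s(u, v)) :
    ∃ C : Sym2 V → Fin q, Good H F C ∧ ∀ k u v, (P k).Adj u v → C s(u, v) = c k s(u, v) := by
  classical
  let C : Sym2 V → Fin q := fun e => if h : ∃ k, e ∈ (P k).edgeSet then c h.choose e else 0
  have hC : ∀ k u v, (P k).Adj u v → C s(u, v) = c k s(u, v) := by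
    intro k u v h
    have hex : ∃ k, s(u, v) ∈ (P k).edgeSet := ⟨k, h⟩
    simp only [C, dif_pos hex]
    exact hcc _ _ u v hex.choose_spec h
  refine ⟨C, ?_, hC⟩
  rintro ⟨i, f, hf⟩
  obtain ⟨k, hk⟩ := hP f fun a b hab => hF _ _ (hf a b hab).1
  exact hc k ⟨i, f, fun a b hab => ⟨hk a b hab, (hC k _ _ (hk a b hab)) ▸ (hf a b hab).2⟩⟩

theorem exists_mono_finset {q : ℕ} (m : ℕ) : ∀ k : Fin q → ℕ, ∑ i, k i = m →
    ∃ N : ℕ, ∀ (V : Type) (c : Sym2 V → Fin q) (S : Finset V), N ≤ S.card →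
      ∃ i, ∃ T ⊆ S, T.card = k i ∧ ∀ a ∈ T, ∀ b ∈ T, a ≠ b → c s(a, b) = i := by
  classical
  induction m with
  | zero =>
    intro k hk
    refine ⟨1, fun V c S hS => ?_⟩
    obtain ⟨x, -⟩ := Finset.card_pos.1 hS
    refine ⟨c s(x, x), ∅, by simp, ?_, by simp⟩
    simpa using ((Finset.sum_eq_zero_iff.1 hk) (c s(x, x)) (Finset.mem_univ _)).symm
  | succ m ih =>
    intro k hk
    by_cases h0 : ∃ i, k i = 0
    · obtain ⟨i, hi⟩ := h0
      exact ⟨0, fun V c S _ => ⟨i, ∅, by simp, by simp [hi], by simp⟩⟩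
    push Not at h0
    have hrec : ∀ i, ∑ j, Function.update k i (k i - 1) j = m := by
      intro i
      have h1 := Finset.add_sum_erase Finset.univ k (Finset.mem_univ i)
      have h2 := Finset.add_sum_erase Finset.univ (Function.update k i (k i - 1))
        (Finset.mem_univ i)
      have h3 : ∑ j ∈ Finset.univ.erase i, Function.update k i (k i - 1) j =
          ∑ j ∈ Finset.univ.erase i, k j :=
        Finset.sum_congr rfl fun j hj => Function.update_of_ne (Finset.ne_of_mem_erase hj) _ _
      rw [h3, Function.update_self] at h2
      have := h0 i
      omega
    choose N hN using fun i => ih _ (hrec i)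
    refine ⟨q * (∑ i, N i) + 1, fun V c S hS => ?_⟩
    obtain ⟨x, hx⟩ : S.Nonempty := Finset.card_pos.1 (by omega)
    have hcard : (Finset.univ : Finset (Fin q)).card * ∑ i, N i ≤ (S.erase x).card := by
      rw [Finset.card_erase_of_mem hx, Finset.card_univ, Fintype.card_fin]
      omega
    obtain ⟨i, -, hi⟩ := Finset.exists_le_card_fiber_of_mul_le_card_of_maps_to
      (f := fun y => c s(x, y)) (fun a _ => Finset.mem_univ _)
      ⟨c s(x, x), Finset.mem_univ _⟩ hcard
    obtain ⟨j, T, hT, hTc, hTm⟩ := hN i V c _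
      ((Finset.single_le_sum (fun _ _ => Nat.zero_le _) (Finset.mem_univ i)).trans hi)
    have hTS : ∀ y ∈ T, y ∈ S ∧ y ≠ x ∧ c s(x, y) = i := by
      intro y hy
      have := hT hy
      simp only [Finset.mem_filter, Finset.mem_erase] at this
      exact ⟨this.1.2, this.1.1, this.2⟩
    by_cases hji : j = i
    · subst hji
      refine ⟨j, insert x T, ?_, ?_, ?_⟩
      · exact Finset.insert_subset hx fun y hy => (hTS y hy).1
      · rw [Finset.card_insert_of_notMem fun h => (hTS x h).2.1 rfl, hTc, Function.update_self]
        have := h0 j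
        omega
      · intro a ha b hb hab
        rcases Finset.mem_insert.1 ha with rfl | ha'
        · rcases Finset.mem_insert.1 hb with rfl | hb
          · exact absurd rfl hab
          · exact (hTS b hb).2.2
        · rcases Finset.mem_insert.1 hb with rfl | hb
          · rw [Sym2.eq_swap]
            exact (hTS a ha').2.2
          · exact hTm a ha' b hb hab
    · refine ⟨j, T, fun y hy => (hTS y hy).1, ?_, hTm⟩
      rw [hTc, Function.update_of_ne hji]

theorem exists_isRamsey_top (q : ℕ) {W : Type} [Fintype W] (H : SimpleGraph W) :
    ∃ N, IsRamsey q (⊤ : SimpleGraph (Fin N)) H := by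
  obtain ⟨N, hN⟩ := exists_mono_finset (q := q) _ (fun _ => Fintype.card W) rfl
  refine ⟨N, fun c => ?_⟩
  obtain ⟨i, T, -, hT, hTm⟩ := hN (Fin N) c Finset.univ (by simp)
  have e : W ≃ T := Fintype.equivOfCardEq (by simp [hT])
  refine ⟨i, e.toEmbedding.trans (Function.Embedding.subtype _), fun a b hab => ?_⟩
  have hne : ((e a : T) : Fin N) ≠ e b := fun h => hab.ne (e.injective (Subtype.ext h))
  exact ⟨hne, hTm _ (e a).2 _ (e b).2 hne⟩

/-- A graph with a vertex `x` and neighbours `leaf a` of `x` such that the star from `x` to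
these neighbours is never monochromatic in an `H`-free colouring, and such colourings exist. -/
theorem exists_star {q : ℕ} (hq : 2 ≤ q) {W : Type} [Fintype W] {H : SimpleGraph W}
    (hH : StrongConn H) :
    ∃ (V : Type) (_ : Finite V) (U : SimpleGraph V) (x : V) (A : Set V),
      (∀ a ∈ A, U.Adj x a) ∧ (∃ c : Sym2 V → Fin q, Good H U c) ∧
      ∀ c : Sym2 V → Fin q, Good H U c → ¬ ∃ k, ∀ a ∈ A, c s(x, a) = k := by
  classical
  obtain ⟨N, hN⟩ := exists_isRamsey_top q H
  obtain ⟨F, hF, hmin⟩ := Set.Finite.exists_minimal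
    (s := {F : SimpleGraph (Fin N) | IsRamsey q F H}) (Set.toFinite _) ⟨_, hN⟩
  obtain ⟨a₀, b₀, _, _, hab₀, -⟩ := hH.exists_path
  obtain ⟨i₀, f₀, hf₀⟩ := hF (fun _ => ⟨0, by omega⟩)
  have hxy := (hf₀ a₀ b₀ hab₀).1
  set x := f₀ a₀
  set y := f₀ b₀
  let R : Finset (Fin N) → SimpleGraph (Fin N) :=
    fun B => F.deleteEdges {e | ∃ b, e = s(x, b) ∧ b ∉ B}
  have hR : ∀ B u v, (R B).Adj u v ↔ F.Adj u v ∧ ∀ b, s(u, v) = s(x, b) → b ∈ B := by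
    intro B u v
    simp only [R, deleteEdges_adj, Set.mem_ofPred_eq, not_exists, not_and, not_not]
  have hRx : ∀ B v, (R B).Adj x v ↔ F.Adj x v ∧ v ∈ B := by
    intro B v
    rw [hR]
    refine and_congr_right fun hv => ⟨fun h => h v rfl, fun h b hb => ?_⟩
    rwa [← Sym2.congr_right.1 hb]
  let T : Finset (Fin N) → Prop := fun B => ∀ c : Sym2 (Fin N) → Fin q, Good H (R B) c →
    ¬ ∃ k, ∀ b ∈ B, F.Adj x b → c s(x, b) = k
  have hT0 : ¬ T ∅ := by
    intro hT
    have hlt : ¬ IsRamsey q (R ∅) H := by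
      intro hram
      have := hmin hram (deleteEdges_le _) hxy
      rw [hRx] at this
      simp at this
    obtain ⟨c, hc⟩ := not_isRamsey_iff.1 hlt
    exact hT c hc ⟨⟨0, by omega⟩, by simp⟩
  have hT1 : T Finset.univ := by
    intro c hc
    refine (hc ?_).elim
    have : R Finset.univ = F := by
      ext u v
      simp [hR]
    rw [this]
    exact hF c
  obtain ⟨a, B, haB, hB, hBa⟩ : ∃ a B, a ∉ B ∧ ¬ T B ∧ T (insert a B) := by
    by_contra! hcon
    exact (Finset.induction (motive := fun B => ¬ T B) hT0 (fun a B ha hB => hcon a B ha hB)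
      Finset.univ) hT1
  refine ⟨Fin N, inferInstance, R (insert a B), x, {b | b ∈ insert a B ∧ F.Adj x b},
    fun b hb => (hRx _ _).2 ⟨hb.2, hb.1⟩, ?_, ?_⟩
  · simp only [T, not_forall, not_not] at hB
    obtain ⟨c, hc, k, hk⟩ := hB
    obtain ⟨j, hj⟩ : ∃ j : Fin q, j ≠ k := by
      have : Nontrivial (Fin q) := Fin.nontrivial_iff_two_le.2 hq
      exact exists_ne k
    refine ⟨Function.update c s(x, a) j, ?_⟩
    rintro ⟨i, f, hf⟩
    have hstep : ∀ w w', H.Adj w w' → s(f w, f w') ≠ s(x, a) := by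
      have aux : ∀ w w', H.Adj w w' → f w = x → f w' = a → False := by
        intro w w' hww hw hw'
        have h1 := (hf w w' hww).2
        rw [hw, hw', Function.update_self] at h1
        obtain ⟨w'', hne, hadj⟩ := hH.exists_adj_ne w w'
        have h2 := hf w w'' hadj
        have h3 : f w'' ≠ a := fun h => hne (f.injective (h.trans hw'.symm))
        rw [hw, hRx, Finset.mem_insert] at h2
        rw [Function.update_of_ne (fun h => h3 (Sym2.congr_right.1 h)),
          hk _ (h2.1.2.resolve_left h3) h2.1.1] at h2
        exact hj (h1.trans h2.2.symm)
      intro w w' hww h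
      rcases Sym2.eq_iff.1 h with ⟨h1, h2⟩ | ⟨h1, h2⟩
      · exact aux w w' hww h1 h2
      · exact aux w' w hww.symm h2 h1
    refine hc ⟨i, f, fun w w' hww => ?_⟩
    obtain ⟨h1, h2⟩ := hf w w' hww
    rw [Function.update_of_ne (hstep w w' hww)] at h2
    refine ⟨?_, h2⟩
    rw [hR] at h1 ⊢
    refine ⟨h1.1, fun b hb => (Finset.mem_insert.1 (h1.2 b hb)).resolve_left ?_⟩
    rintro rfl
    exact hstep w w' hww hb
  · intro c hc
    rintro ⟨k, hk⟩
    exact hBa c hc ⟨k, fun b hb hxb => hk b ⟨hb, hxb⟩⟩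

section Hypergraph

variable {I A Y : Type}

/-- The hypergraph with edges `f i` is not properly `q`-colourable. -/
def NotColorable (q : ℕ) (f : I → A → Y) : Prop :=
  ∀ χ : Y → Fin q, ∃ i k, ∀ α, χ (f i α) = k

/-- Among any at most `n` edges, rooted at any vertex, one meets the union of the others and the
root in at most one vertex. -/
def RootedLeafFree (f : I → A → Y) (n : ℕ) : Prop :=
  ∀ J : Finset I, J.Nonempty → J.card ≤ n → ∀ y₀ : Y, ∃ i ∈ J, ∃ y, ∀ α,
    (f i α = y₀ ∨ ∃ l ∈ J, l ≠ i ∧ ∃ β, f l β = f i α) → f i α = y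

theorem RootedLeafFree.exists_ne [Nonempty A] {f : I → A → Y} {n : ℕ} (h : RootedLeafFree f n)
    {J : Finset I} (h2 : 2 ≤ J.card) (hn : J.card ≤ n) (p : I) :
    ∃ i ∈ J, i ≠ p ∧ ∃ y, ∀ α, (∃ l ∈ J, l ≠ i ∧ ∃ β, f l β = f i α) → f i α = y := by
  classical
  obtain ⟨i, hi, y, hy⟩ := h J (Finset.card_pos.1 (by omega)) hn (f p (Classical.arbitrary A))
  by_cases hip : i = p
  swap
  · exact ⟨i, hi, hip, y, fun α h => hy α (Or.inr h)⟩
  subst hip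
  have hc : (J.erase i).card = J.card - 1 := Finset.card_erase_of_mem hi
  obtain ⟨j, hj, y', hy'⟩ := h (J.erase i) (Finset.card_pos.1 (by omega)) (by omega) y
  obtain ⟨hji, hjJ⟩ := Finset.mem_erase.1 hj
  refine ⟨j, hjJ, hji, y', ?_⟩
  rintro α ⟨l, hl, hlj, β, hβ⟩
  by_cases hli : l = i
  · subst hli
    exact hy' α (Or.inl (hβ ▸ hy β (Or.inr ⟨j, hjJ, hji, α, hβ.symm⟩)))
  · exact hy' α (Or.inr ⟨l, Finset.mem_erase.2 ⟨hli, hl⟩, hlj, β, hβ⟩)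

theorem RootedLeafFree.of_comp {Z : Type} {f : I → A → Y} {n : ℕ} {g : Y → Z}
    (h : RootedLeafFree (fun i α => g (f i α)) n)
    (hg : ∀ i, Function.Injective fun α => g (f i α)) : RootedLeafFree f n := by
  intro J hJ hn y₀
  obtain ⟨i, hi, z, hz⟩ := h J hJ hn (g y₀)
  have hz' : ∀ α, (f i α = y₀ ∨ ∃ l ∈ J, l ≠ i ∧ ∃ β, f l β = f i α) → g (f i α) = z := by
    rintro α (hα | ⟨l, hl, hli, β, hβ⟩)
    · exact hz α (Or.inl (congrArg g hα))
    · exact hz α (Or.inr ⟨l, hl, hli, β, congrArg g hβ⟩)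
  by_cases hex : ∃ α, g (f i α) = z
  · obtain ⟨α₀, hα₀⟩ := hex
    exact ⟨i, hi, f i α₀, fun α hα => by rw [hg i ((hz' α hα).trans hα₀.symm)]⟩
  · exact ⟨i, hi, y₀, fun α hα => (hex ⟨α, hz' α hα⟩).elim⟩

theorem exists_embedding_const (q : ℕ) (A : Type) [Finite A] :
    ∃ a : ℕ, ∀ κ : Fin a → Fin q, ∃ β : A ↪ Fin a, ∃ k, ∀ α, κ (β α) = k := by
  classical
  have := Fintype.ofFinite A
  refine ⟨q * Fintype.card A + 1, fun κ => ?_⟩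
  obtain ⟨k, -, hk⟩ := Finset.exists_le_card_fiber_of_mul_le_card_of_maps_to
    (s := Finset.univ) (t := Finset.univ) (n := Fintype.card A) (f := κ)
    (fun a _ => Finset.mem_univ _) ⟨κ 0, Finset.mem_univ _⟩ (by simp)
  rw [← Fintype.card_coe] at hk
  obtain ⟨β⟩ := Function.Embedding.nonempty_of_card_le hk
  refine ⟨β.trans (Function.Embedding.subtype _), k, fun α => ?_⟩
  exact (Finset.mem_filter.1 (β α).2).2

/-- An `a`-partite hypergraph whose `q`-colourings all look canonical, on the first `r` parts, on
some edge over each choice of parts. -/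
def Canonical (q r : ℕ) {a : ℕ} (f : I → A → Y) (part : Y → Fin a) : Prop :=
  ∀ χ : Y → Fin q, ∃ κ : Fin a → Fin q, ∀ β : A ↪ Fin a, ∃ i,
    (∀ α, part (f i α) = β α) ∧ ∀ α, (β α).val < r → χ (f i α) = κ (β α)

section Amalgam

variable {I' Y' : Type} {a : ℕ} (part : Y → Fin a) (r : Fin a)
  (f' : I' → {y // part y = r} → Y')

open Classical in
/-- The copy of the vertex set `Y` indexed by `p`, with part `r` identified with the edge
`f' p`. -/
noncomputable def amalgam (p : I') (y : Y) : Y' ⊕ (I' × Y) :=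
  if h : part y = r then Sum.inl (f' p ⟨y, h⟩) else Sum.inr (p, y)

variable {part r f'}

theorem amalgam_of_eq (p : I') {y : Y} (h : part y = r) :
    amalgam part r f' p y = Sum.inl (f' p ⟨y, h⟩) :=
  dif_pos h

theorem amalgam_of_ne (p : I') {y : Y} (h : part y ≠ r) :
    amalgam part r f' p y = Sum.inr (p, y) :=
  dif_neg h

theorem amalgam_injective (hf' : ∀ p, Function.Injective (f' p)) (p : I') :
    Function.Injective (amalgam part r f' p) := by
  intro y z hyz
  by_cases hy : part y = r <;> by_cases hz : part z = r
  · rw [amalgam_of_eq p hy, amalgam_of_eq p hz] at hyz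
    exact congrArg Subtype.val (hf' p (Sum.inl_injective hyz))
  · rw [amalgam_of_eq p hy, amalgam_of_ne p hz] at hyz
    cases hyz
  · rw [amalgam_of_ne p hy, amalgam_of_eq p hz] at hyz
    cases hyz
  · rw [amalgam_of_ne p hy, amalgam_of_ne p hz] at hyz
    exact congrArg Prod.snd (Sum.inr_injective hyz)

theorem eq_of_amalgam_eq {p p' : I'} (hp : p' ≠ p) {y z : Y}
    (h : amalgam part r f' p' z = amalgam part r f' p y) :
    ∃ (hy : part y = r) (v : {y // part y = r}), f' p' v = f' p ⟨y, hy⟩ := by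
  by_cases hy : part y = r <;> by_cases hz : part z = r
  · rw [amalgam_of_eq p hy, amalgam_of_eq p' hz] at h
    exact ⟨hy, ⟨z, hz⟩, Sum.inl_injective h⟩
  · rw [amalgam_of_eq p hy, amalgam_of_ne p' hz] at h
    cases h
  · rw [amalgam_of_ne p hy, amalgam_of_eq p' hz] at h
    cases h
  · rw [amalgam_of_ne p hy, amalgam_of_ne p' hz] at h
    exact (hp (congrArg Prod.fst (Sum.inr_injective h))).elim

theorem RootedLeafFree.amalgam [Nonempty A] {n : ℕ} {f : I → A → Y}
    (hf : RootedLeafFree f (n + 1)) (hpart : ∀ i, Function.Injective fun α => part (f i α))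
    (hr : Nonempty {y // part y = r})
    (hf' : ∀ p, Function.Injective (f' p)) (hlf' : RootedLeafFree f' n) :
    RootedLeafFree (fun (x : I' × I) α => amalgam part r f' x.1 (f x.2 α)) (n + 1) := by
  classical
  intro J hJ hn y₀
  let J' := J.image Prod.fst
  have hJ' : ∀ x ∈ J, x.1 ∈ J' := fun x hx => Finset.mem_image_of_mem _ hx
  have hJ'n : J'.card ≤ n + 1 := Finset.card_image_le.trans hn
  -- it suffices to find a copy attached to the rest and the root at a single vertex
  have lift : ∀ p ∈ J', ∀ z₀ : Y, (∀ i, (p, i) ∈ J → ∀ α, (_root_.amalgam part r f' p (f i α) = y₀ ∨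
      ∃ x ∈ J, x.1 ≠ p ∧ ∃ β, _root_.amalgam part r f' x.1 (f x.2 β) =
        _root_.amalgam part r f' p (f i α)) → f i α = z₀) →
      ∃ x ∈ J, ∃ y, ∀ α, (_root_.amalgam part r f' x.1 (f x.2 α) = y₀ ∨ ∃ l ∈ J, l ≠ x ∧ ∃ β,
        _root_.amalgam part r f' l.1 (f l.2 β) = _root_.amalgam part r f' x.1 (f x.2 α)) →
        _root_.amalgam part r f' x.1 (f x.2 α) = y := by
    intro p hp z₀ hz₀
    let Jp := (J.filter fun x => x.1 = p).image Prod.snd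
    have hJp : ∀ i, i ∈ Jp ↔ (p, i) ∈ J := by
      intro i
      simp only [Jp, Finset.mem_image, Finset.mem_filter]
      constructor
      · rintro ⟨⟨_, _⟩, ⟨h1, rfl⟩, rfl⟩
        exact h1
      · exact fun h => ⟨(p, i), ⟨h, rfl⟩, rfl⟩
    have hne : Jp.Nonempty := by
      obtain ⟨⟨_, i⟩, hx, rfl⟩ := Finset.mem_image.1 hp
      exact ⟨i, (hJp i).2 hx⟩
    obtain ⟨i, hi, y, hy⟩ := hf Jp hne
      ((Finset.card_image_le.trans (Finset.card_filter_le _ _)).trans hn) z₀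
    rw [hJp] at hi
    refine ⟨(p, i), hi, _root_.amalgam part r f' p y, fun α hα => congrArg _ (hy α ?_)⟩
    rcases hα with hα | ⟨⟨p', j⟩, hl, hlx, β, hβ⟩
    · exact Or.inl (hz₀ i hi α (Or.inl hα))
    · by_cases hpp : p' = p
      · subst hpp
        exact Or.inr ⟨j, (hJp j).2 hl, fun h => hlx (h ▸ rfl), β, amalgam_injective hf' _ hβ⟩
      · exact Or.inl (hz₀ i hi α (Or.inr ⟨_, hl, hpp, β, hβ⟩))
  have lift' : ∀ p ∈ J', ∀ y' : Y', (∀ z, y₀ ≠ Sum.inr (p, z)) →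
      (∀ i, (p, i) ∈ J → ∀ α, ∀ h : part (f i α) = r, (y₀ = Sum.inl (f' p ⟨f i α, h⟩) ∨
        ∃ p' ∈ J', p' ≠ p ∧ ∃ v, f' p' v = f' p ⟨f i α, h⟩) → f' p ⟨f i α, h⟩ = y') →
      ∃ x ∈ J, ∃ y, ∀ α, (_root_.amalgam part r f' x.1 (f x.2 α) = y₀ ∨ ∃ l ∈ J, l ≠ x ∧ ∃ β,
        _root_.amalgam part r f' l.1 (f l.2 β) = _root_.amalgam part r f' x.1 (f x.2 α)) →
        _root_.amalgam part r f' x.1 (f x.2 α) = y := by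
    intro p hp y' h1 h2
    have h3 : ∃ z₀ : Y, ∀ v, f' p v = y' → v.1 = z₀ := by
      by_cases hex : ∃ v, f' p v = y'
      · obtain ⟨v, hv⟩ := hex
        exact ⟨v, fun w hw => congrArg _ (hf' p (hw.trans hv.symm))⟩
      · exact ⟨hr.some, fun v hv => (hex ⟨v, hv⟩).elim⟩
    obtain ⟨z₀, hz₀⟩ := h3
    refine lift p hp z₀ ?_
    rintro i hi α (hα | ⟨x, hx, hxp, β, hβ⟩)
    · by_cases h : part (f i α) = r
      · rw [amalgam_of_eq p h] at hα
        exact hz₀ ⟨f i α, h⟩ (h2 i hi α h (Or.inl hα.symm))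
      · rw [amalgam_of_ne p h] at hα
        exact (h1 _ hα.symm).elim
    · obtain ⟨h, v, hv⟩ := eq_of_amalgam_eq hxp hβ
      exact hz₀ ⟨f i α, h⟩ (h2 i hi α h (Or.inr ⟨_, hJ' x hx, hxp, v, hv⟩))
  have hJ'ne : J'.Nonempty := hJ.image _
  by_cases h1 : J'.card ≤ 1
  · obtain ⟨p, hp⟩ := Finset.card_eq_one.1 (le_antisymm h1 (Finset.card_pos.2 hJ'ne))
    have hz₀ : ∃ z₀ : Y, ∀ y, _root_.amalgam part r f' p y = y₀ → y = z₀ := by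
      by_cases hex : ∃ y, _root_.amalgam part r f' p y = y₀
      · obtain ⟨v, hv⟩ := hex
        exact ⟨v, fun w hw => amalgam_injective hf' p (hw.trans hv.symm)⟩
      · exact ⟨hr.some, fun v hv => (hex ⟨v, hv⟩).elim⟩
    obtain ⟨z₀, hz₀⟩ := hz₀
    refine lift p (hp ▸ Finset.mem_singleton_self p) z₀ ?_
    rintro i hi α (hα | ⟨x, hx, hxp, β, hβ⟩)
    · exact hz₀ _ hα
    · exact (hxp (Finset.mem_singleton.1 (hp ▸ hJ' x hx))).elim
  push Not at h1
  by_cases h2 : J'.card ≤ n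
  · rcases y₀ with y' | ⟨p₀, z⟩
    · obtain ⟨p, hp, y, hy⟩ := hlf' J' hJ'ne h2 y'
      refine lift' p hp y (by simp) ?_
      rintro i hi α h (hα | hα)
      · exact hy _ (Or.inl (Sum.inl_injective hα).symm)
      · exact hy _ (Or.inr hα)
    · obtain ⟨p, hp, hpp, y, hy⟩ := hlf'.exists_ne h1 h2 p₀
      refine lift' p hp y (fun z' h => ?_) ?_
      · exact hpp (congrArg Prod.fst (Sum.inr_injective h)).symm
      · rintro i hi α h (hα | hα)
        · cases hα
        · exact hy _ hα
  · have hinj : Set.InjOn Prod.fst (J : Set (I' × I)) :=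
      Finset.card_image_iff.1 (le_antisymm Finset.card_image_le (by
        change J.card ≤ J'.card
        omega))
    obtain ⟨p, hp, hpy⟩ : ∃ p ∈ J', ∀ z, y₀ ≠ Sum.inr (p, z) := by
      rcases y₀ with y' | ⟨p₀, z⟩
      · obtain ⟨p, hp⟩ := hJ'ne
        exact ⟨p, hp, by simp⟩
      · obtain ⟨p, hp, hpp⟩ := Finset.exists_mem_ne h1 p₀
        exact ⟨p, hp, fun z' h => hpp (congrArg Prod.fst (Sum.inr_injective h)).symm⟩
    have hex : ∃ y', ∀ i, (p, i) ∈ J → ∀ α, ∀ h : part (f i α) = r,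
        f' p ⟨f i α, h⟩ = y' := by
      by_cases hex : ∃ i, (p, i) ∈ J ∧ ∃ α, part (f i α) = r
      · obtain ⟨i, hi, α, hα⟩ := hex
        refine ⟨f' p ⟨f i α, hα⟩, fun j hj β hβ => ?_⟩
        have hij : i = j := congrArg Prod.snd (hinj hi hj rfl)
        subst hij
        have := hpart i (hβ.trans hα.symm)
        subst this
        rfl
      · exact ⟨f' p hr.some, fun i hi α h => (hex ⟨i, hi, α, h⟩).elim⟩
    obtain ⟨y', hy'⟩ := hex
    exact lift' p hp y' hpy fun i hi α h _ => hy' i hi α h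

end Amalgam

theorem exists_partite (q n a : ℕ) [NeZero q] (A : Type) [Finite A] [Nonempty A]
    (ih : ∀ (A : Type) [Finite A] [Nonempty A], ∃ (I Y : Type) (_ : Finite I) (_ : Finite Y)
      (f : I → A → Y), (∀ i, Function.Injective (f i)) ∧ NotColorable q f ∧ RootedLeafFree f n)
    (r : ℕ) (hr : r ≤ a) :
    ∃ (I Y : Type) (_ : Finite I) (_ : Finite Y) (f : I → A → Y) (part : Y → Fin a),
      (∀ i, Function.Injective fun α => part (f i α)) ∧ RootedLeafFree f (n + 1) ∧
      Canonical q r f part := by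
  classical
  induction r with
  | zero =>
    refine ⟨A ↪ Fin a, (A ↪ Fin a) × A, inferInstance, inferInstance, fun i α => (i, α),
      fun y => y.1 y.2, fun i => i.injective, ?_, ?_⟩
    · rintro J ⟨i, hi⟩ - y₀
      refine ⟨i, hi, y₀, ?_⟩
      rintro α (h | ⟨l, -, hli, β, hβ⟩)
      · exact h
      · exact (hli (congrArg Prod.fst hβ)).elim
    · intro χ
      exact ⟨fun _ => 0, fun β => ⟨β, fun _ => rfl, fun α h => absurd h (Nat.not_lt_zero _)⟩⟩
  | succ r ihr =>
    obtain ⟨I, Y, _, _, f, part, hpart, hlf, hcan⟩ := ihr (by omega)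
    set r' : Fin a := ⟨r, by omega⟩
    by_cases hV : Nonempty {y // part y = r'}
    · obtain ⟨I', Y', _, _, f', hf', hnc, hlf'⟩ := ih {y // part y = r'}
      have hp2 : ∀ p y, Sum.elim (fun _ => r') (fun x : I' × Y => part x.2)
          (amalgam part r' f' p y) = part y := by
        intro p y
        by_cases h : part y = r'
        · rw [amalgam_of_eq p h]
          exact h.symm
        · rw [amalgam_of_ne p h]
          rfl
      refine ⟨I' × I, Y' ⊕ (I' × Y), inferInstance, inferInstance,
        fun x α => amalgam part r' f' x.1 (f x.2 α),
        Sum.elim (fun _ => r') fun x => part x.2, ?_, hlf.amalgam hpart hV hf' hlf', ?_⟩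
      · intro x
        simp only [hp2]
        exact hpart x.2
      · intro χ
        obtain ⟨p, k, hk⟩ := hnc fun y => χ (Sum.inl y)
        obtain ⟨κ, hκ⟩ := hcan fun y => χ (amalgam part r' f' p y)
        refine ⟨Function.update κ r' k, fun β => ?_⟩
        obtain ⟨i, hi, hi'⟩ := hκ β
        refine ⟨(p, i), fun α => (hp2 _ _).trans (hi α), fun α hα => ?_⟩
        by_cases h : β α = r'
        · have h' : part (f i α) = r' := (hi α).trans h
          rw [h, Function.update_self]
          simp only
          rw [amalgam_of_eq p h']
          exact hk _
        · rw [Function.update_of_ne h]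
          refine hi' α (lt_of_le_of_ne (Nat.lt_succ_iff.1 hα) fun h' => h (Fin.ext h'))
    · refine ⟨I, Y, ‹_›, ‹_›, f, part, hpart, hlf, fun χ => ?_⟩
      obtain ⟨κ, hκ⟩ := hcan χ
      refine ⟨κ, fun β => ?_⟩
      obtain ⟨i, hi, hi'⟩ := hκ β
      refine ⟨i, hi, fun α hα => hi' α (lt_of_le_of_ne (Nat.lt_succ_iff.1 hα) fun h' => ?_)⟩
      exact hV ⟨f i α, (hi α).trans (Fin.ext h')⟩

theorem exists_leafFree_notColorable (q n : ℕ) [NeZero q] (A : Type) [Finite A] [Nonempty A] :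
    ∃ (I Y : Type) (_ : Finite I) (_ : Finite Y) (f : I → A → Y),
      (∀ i, Function.Injective (f i)) ∧ NotColorable q f ∧ RootedLeafFree f n := by
  induction n generalizing A with
  | zero =>
    obtain ⟨a, ha⟩ := exists_embedding_const q A
    refine ⟨A ↪ Fin a, Fin a, inferInstance, inferInstance, fun i => i, fun i => i.injective,
      ha, fun J hJ hn => ?_⟩
    have := Finset.card_pos.2 hJ
    omega
  | succ n ih =>
    obtain ⟨a, ha⟩ := exists_embedding_const q A
    obtain ⟨I, Y, _, _, f, part, hpart, hlf, hcan⟩ := exists_partite q n a A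
      (fun A _ _ => ih A) a le_rfl
    refine ⟨I, Y, ‹_›, ‹_›, f, fun i α β h => hpart i (congrArg part h), fun χ => ?_, hlf⟩
    obtain ⟨κ, hκ⟩ := hcan χ
    obtain ⟨β, k, hβ⟩ := ha κ
    obtain ⟨i, -, hi⟩ := hκ β
    exact ⟨i, k, fun α => (hi α (β α).2).trans (hβ α)⟩

end Hypergraph

section Glue

variable {K B : Type} {T : K → Type} (π : ∀ k, T k → Option B) (S : ∀ k, SimpleGraph (T k))

/-- The embedding of the `k`-th piece in a gluing: vertices placed by `π` go to common vertices,
the others to private ones. -/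
def glueEmb (k : K) (v : T k) : B ⊕ (Σ k, T k) :=
  (π k v).elim (Sum.inr ⟨k, v⟩) Sum.inl

/-- The `k`-th piece of a gluing. -/
def gluePiece (k : K) : SimpleGraph (B ⊕ (Σ k, T k)) :=
  (S k).map (glueEmb π k)

/-- The union of the pieces `S k`, glued along the vertices placed by `π`. -/
def glue : SimpleGraph (B ⊕ (Σ k, T k)) :=
  ⨆ k, gluePiece π S k

/-- Each `π k` is injective where it is defined. -/
def PlacedInj : Prop :=
  ∀ k u v b, π k u = some b → π k v = some b → u = v

variable {π S}

theorem glueEmb_of_some {k : K} {v : T k} {b : B} (h : π k v = some b) :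
    glueEmb π k v = Sum.inl b := by
  simp [glueEmb, h]

theorem glueEmb_of_none {k : K} {v : T k} (h : π k v = none) :
    glueEmb π k v = Sum.inr ⟨k, v⟩ := by
  simp [glueEmb, h]

theorem glueEmb_eq_inl {k : K} {v : T k} {b : B} : glueEmb π k v = Sum.inl b ↔ π k v = some b := by
  refine ⟨fun h => ?_, glueEmb_of_some⟩
  cases hv : π k v with
  | none => rw [glueEmb_of_none hv] at h; cases h
  | some b' => rw [glueEmb_of_some hv] at h; rw [Sum.inl_injective h]

theorem PlacedInj.injective (hπ : PlacedInj π) (k : K) : Function.Injective (glueEmb π k) := by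
  intro u v h
  cases hu : π k u with
  | some b =>
    rw [glueEmb_of_some hu, eq_comm, glueEmb_eq_inl] at h
    exact hπ k u v b hu h
  | none =>
    cases hv : π k v with
    | some b =>
      rw [glueEmb_of_none hu, glueEmb_of_some hv] at h
      cases h
    | none =>
      rw [glueEmb_of_none hu, glueEmb_of_none hv] at h
      exact eq_of_heq (Sigma.mk.inj (Sum.inr_injective h)).2

theorem exists_of_glueEmb_eq {k l : K} (hkl : k ≠ l) {u : T k} {v : T l}
    (h : glueEmb π k u = glueEmb π l v) : ∃ b, π k u = some b ∧ π l v = some b := by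
  cases hu : π k u with
  | some b =>
    rw [glueEmb_of_some hu, eq_comm, glueEmb_eq_inl] at h
    exact ⟨b, rfl, h⟩
  | none =>
    cases hv : π l v with
    | some b =>
      rw [glueEmb_of_none hu, glueEmb_of_some hv] at h
      cases h
    | none =>
      rw [glueEmb_of_none hu, glueEmb_of_none hv] at h
      exact (hkl (Sigma.mk.inj (Sum.inr_injective h)).1).elim

theorem PlacedInj.gluePiece_adj (hπ : PlacedInj π) {k : K} {u v : T k} :
    (gluePiece π S k).Adj (glueEmb π k u) (glueEmb π k v) ↔ (S k).Adj u v := by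
  have := SimpleGraph.map_adj_apply (G := S k) (f := ⟨_, hπ.injective k⟩) (a := u) (b := v)
  exact this

theorem exists_of_gluePiece_adj {k : K} {u v : B ⊕ (Σ k, T k)} (h : (gluePiece π S k).Adj u v) :
    ∃ u' v', (S k).Adj u' v' ∧ glueEmb π k u' = u ∧ glueEmb π k v' = v := by
  rw [gluePiece, SimpleGraph.map_adj'] at h
  exact h.2

theorem glue_adj {u v : B ⊕ (Σ k, T k)} :
    (glue π S).Adj u v ↔ ∃ k, (gluePiece π S k).Adj u v := by
  rw [glue, iSup_adj]

theorem PlacedInj.glue_adj_of_adj (hπ : PlacedInj π) {k : K} {u v : T k} (h : (S k).Adj u v) :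
    (glue π S).Adj (glueEmb π k u) (glueEmb π k v) :=
  glue_adj.2 ⟨k, hπ.gluePiece_adj.2 h⟩

/-- A vertex common to two pieces is a placed one. -/
theorem exists_of_support {k l : K} (hkl : k ≠ l) {w : B ⊕ (Σ k, T k)}
    (hk : ∃ z, (gluePiece π S k).Adj w z) (hl : ∃ z, (gluePiece π S l).Adj w z) :
    ∃ b u v, w = Sum.inl b ∧ π k u = some b ∧ π l v = some b := by
  obtain ⟨z, hz⟩ := hk
  obtain ⟨z', hz'⟩ := hl
  obtain ⟨u, _, _, hu, _⟩ := exists_of_gluePiece_adj hz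
  obtain ⟨v, _, _, hv, _⟩ := exists_of_gluePiece_adj hz'
  obtain ⟨b, hb, hb'⟩ := exists_of_glueEmb_eq hkl (hu.trans hv.symm)
  exact ⟨b, u, v, hu ▸ glueEmb_of_some hb, hb, hb'⟩

theorem PlacedInj.exists_good {q : ℕ} [NeZero q] {W : Type} [Fintype W] {H : SimpleGraph W}
    (hH : StrongConn H) (hπ : PlacedInj π) {J₀ : Finset K} (hJ₀ : J₀.card ≤ 1)
    (hlf : LeafFree (gluePiece π S) J₀ (Fintype.card (W × W) + 1))
    (D : Set (Sym2 (B ⊕ (Σ k, T k)))) (c : ∀ k, Sym2 (T k) → Fin q)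
    (hc : ∀ k, Good H ((S k).deleteEdges (Sym2.map (glueEmb π k) ⁻¹' D)) (c k))
    (hcc : ∀ k l, k ≠ l → ∀ u v u' v' b b', π k u = some b → π l u' = some b →
      π k v = some b' → π l v' = some b' → (S k).Adj u v → (S l).Adj u' v' →
      s(Sum.inl b, Sum.inl b') ∉ D → c k s(u, v) = c l s(u', v')) :
    ∃ C : Sym2 (B ⊕ (Σ k, T k)) → Fin q, Good H ((glue π S).deleteEdges D) C ∧
      ∀ k u v, (S k).Adj u v → s(glueEmb π k u, glueEmb π k v) ∉ D →
        C s(glueEmb π k u, glueEmb π k v) = c k s(u, v) := by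
  let e : ∀ k, Sym2 (B ⊕ (Σ k, T k)) → Fin q :=
    fun k => Function.extend (Sym2.map (glueEmb π k)) (c k) fun _ => 0
  have he : ∀ k u v, e k s(glueEmb π k u, glueEmb π k v) = c k s(u, v) := by
    intro k u v
    have := (Sym2.map.injective (hπ.injective k)).extend_apply (c k) (fun _ => 0) s(u, v)
    simpa only [Sym2.map_mk] using this
  obtain ⟨C, hC, hC'⟩ := NoCross.exists_good (q := q) (F := (glue π S).deleteEdges D) (c := e)
    ((hlf.deleteEdges D).noCross hH hJ₀) (fun u v huv => by
      rw [deleteEdges_adj, glue_adj] at huv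
      obtain ⟨⟨k, hk⟩, hD⟩ := huv
      exact ⟨k, deleteEdges_adj.2 ⟨hk, hD⟩⟩) (fun k => by
      refine ((hc k).map hH (hπ.injective k) (c' := e k) fun u v _ => he k u v).mono ?_
      intro u v huv
      rw [deleteEdges_adj] at huv
      obtain ⟨u', v', h, rfl, rfl⟩ := exists_of_gluePiece_adj huv.1
      rw [SimpleGraph.map_adj']
      exact ⟨huv.1.ne, u', v', deleteEdges_adj.2 ⟨h, huv.2⟩, rfl, rfl⟩) (fun k l u v h1 h2 => by
      by_cases hkl : k = l
      · rw [hkl]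
      rw [deleteEdges_adj] at h1 h2
      obtain ⟨u', v', h, rfl, rfl⟩ := exists_of_gluePiece_adj h1.1
      obtain ⟨u'', v'', h', hu, hv⟩ := exists_of_gluePiece_adj h2.1
      obtain ⟨b, hb, hb'⟩ := exists_of_glueEmb_eq hkl hu.symm
      obtain ⟨b₁, hb₁, hb₁'⟩ := exists_of_glueEmb_eq hkl hv.symm
      rw [he, ← hu, ← hv, he]
      refine hcc k l hkl _ _ _ _ b b₁ hb hb' hb₁ hb₁' h h' ?_
      rw [← glueEmb_of_some hb, ← glueEmb_of_some hb₁]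
      exact h1.2)
  refine ⟨C, hC, fun k u v huv hD => ?_⟩
  rw [hC' k _ _ (deleteEdges_adj.2 ⟨hπ.gluePiece_adj.2 huv, hD⟩), he]

end Glue

/-- The colour pattern `p` on the star from `x` to `A` extends to an `H`-free colouring. -/
def Extends {V W : Type} {q : ℕ} (H : SimpleGraph W) (U : SimpleGraph V) (x : V) {A : Type}
    (leaf : A → V) (p : A → Fin q) : Prop :=
  ∃ c : Sym2 V → Fin q, Good H U c ∧ ∀ a, c s(x, leaf a) = p a

theorem exists_cone {q : ℕ} [NeZero q] {W : Type} [Fintype W] {H : SimpleGraph W}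
    (hH : StrongConn H) {V₀ : Type} [Finite V₀] {U : SimpleGraph V₀} {x₀ : V₀} {A : Type}
    [Nonempty A] {leaf : A → V₀} (hleaf : leaf.Injective) (hU : ∀ a, U.Adj x₀ (leaf a))
    {I Y : Type} [Finite I] [Finite Y] {f : I → A → Y} (hf : ∀ i, Function.Injective (f i))
    (hlf : RootedLeafFree f (Fintype.card (W × W) + 2)) :
    ∃ (V : Type) (_ : Finite V) (P : SimpleGraph V) (x : V) (y : Y → V), y.Injective ∧
      (∀ i a, P.Adj x (y (f i a))) ∧
      (∀ c : Sym2 V → Fin q, Good H P c →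
        ∀ i, Extends H U x₀ leaf fun a => c s(x, y (f i a))) ∧
      ∀ γ : Y → Fin q, (∀ i, Extends H U x₀ leaf fun a => γ (f i a)) →
        ∃ c : Sym2 V → Fin q, Good H P c ∧ ∀ i a, c s(x, y (f i a)) = γ (f i a) := by
  classical
  let π : I → V₀ → Option (Option Y) := fun i v =>
    if v = x₀ then some none else
      if h : ∃ a, leaf a = v then some (some (f i h.choose)) else none
  have hπx : ∀ i, π i x₀ = some none := fun i => if_pos rfl
  have hπl : ∀ i a, π i (leaf a) = some (some (f i a)) := by
    intro i a
    have h : ∃ b, leaf b = leaf a := ⟨a, rfl⟩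
    have h2 : h.choose = a := hleaf h.choose_spec
    simp only [π, if_neg (hU a).ne', dif_pos h, h2]
  have hπ_none : ∀ i v, π i v = some none → v = x₀ := by
    intro i v h
    by_contra hv
    simp only [π, if_neg hv] at h
    split_ifs at h
    simp at h
  have hπ_some : ∀ i v y, π i v = some (some y) → ∃ a, v = leaf a ∧ f i a = y := by
    intro i v y h
    simp only [π] at h
    split_ifs at h with h1 h2
    · simp at h
    · exact ⟨h2.choose, h2.choose_spec.symm, by simpa using h⟩
  have hπ : PlacedInj (T := fun _ => V₀) π := by
    rintro i u v (_ | y) hu hv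
    · rw [hπ_none i u hu, hπ_none i v hv]
    · obtain ⟨a, rfl, rfl⟩ := hπ_some i u y hu
      obtain ⟨b, rfl, hb⟩ := hπ_some i v _ hv
      rw [hf i hb]
  have hex : ∀ i, glueEmb (T := fun _ => V₀) π i x₀ = Sum.inl none :=
    fun i => glueEmb_of_some (hπx i)
  have hel : ∀ i a, glueEmb (T := fun _ => V₀) π i (leaf a) = Sum.inl (some (f i a)) :=
    fun i a => glueEmb_of_some (hπl i a)
  have hLF : LeafFree (gluePiece (T := fun _ => V₀) π fun _ => U) ∅
      (Fintype.card (W × W) + 1) := by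
    intro J _ hJ hn
    by_cases h1 : ∃ k, J = {k}
    · exact Or.inl h1
    right
    obtain ⟨j₀, hj₀⟩ := hJ
    obtain ⟨i, hi, y, hy⟩ := hlf J ⟨j₀, hj₀⟩ (by omega) (f j₀ (Classical.arbitrary A))
    refine ⟨i, hi, by simp, ?_⟩
    have hshared : ∀ w, (∃ z, (gluePiece (T := fun _ => V₀) π (fun _ => U) i).Adj w z) →
        (∃ z, ∃ l ∈ J, l ≠ i ∧ (gluePiece (T := fun _ => V₀) π (fun _ => U) l).Adj w z) →
        w = Sum.inl none ∨ (w = Sum.inl (some y) ∧ ∃ a, f i a = y ∧ ∃ l ∈ J, l ≠ i ∧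
          ∃ β, f l β = y) := by
      rintro w hw ⟨z, l, hl, hli, hz⟩
      obtain ⟨b, u, v, rfl, hu, hv⟩ := exists_of_support hli.symm hw ⟨z, hz⟩
      rcases b with _ | y'
      · exact Or.inl rfl
      · obtain ⟨a, rfl, rfl⟩ := hπ_some i u _ hu
        obtain ⟨β, rfl, hβ⟩ := hπ_some l v _ hv
        have := hy a (Or.inr ⟨l, hl, hli, β, hβ⟩)
        subst this
        exact Or.inr ⟨rfl, a, rfl, l, hl, hli, β, hβ⟩
    by_cases h2 : ∃ a, f i a = y ∧ ∃ l ∈ J, l ≠ i ∧ ∃ β, f l β = y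
    · refine ⟨Sum.inl none, Sum.inl (some y), fun w hw hw' => (hshared w hw hw').imp id And.left,
        ?_⟩
      obtain ⟨a, rfl, l, hl, hli, β, hβ⟩ := h2
      refine iff_of_true ?_ ⟨l, hl, hli, ?_⟩
      · rw [← hex i, ← hel i, hπ.gluePiece_adj]
        exact hU a
      · rw [← hβ, ← hex l, ← hel l, hπ.gluePiece_adj]
        exact hU β
    · refine ⟨Sum.inl none, Sum.inl none, fun w hw hw' => ?_, ?_⟩
      · rcases hshared w hw hw' with h | h
        · exact Or.inl h
        · exact (h2 h.2).elim
      · exact iff_of_false (SimpleGraph.irrefl _) fun ⟨_, _, _, h⟩ => h.ne rfl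
  have hpair : ∀ i l, i ≠ l → ∀ a a' β β', f i a = f l β → f i a' = f l β' → a = a' := by
    intro i l hil a a' β β' h h'
    obtain ⟨j, hj, y, hy⟩ := hlf {i, l} (by simp)
      (Finset.card_le_two.trans (by omega)) (f i a)
    rcases Finset.mem_insert.1 hj with rfl | hj
    · exact hf j ((hy a (Or.inr ⟨l, by simp, hil.symm, β, h.symm⟩)).trans
        (hy a' (Or.inr ⟨l, by simp, hil.symm, β', h'.symm⟩)).symm)
    · rw [Finset.mem_singleton] at hj
      subst hj
      have h3 := (hy β (Or.inr ⟨i, by simp, hil, a, h⟩)).trans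
        (hy β' (Or.inr ⟨i, by simp, hil, a', h'⟩)).symm
      exact hf i (h.trans (h3.trans h'.symm))
  refine ⟨Option Y ⊕ (Σ _ : I, V₀), inferInstance, glue (T := fun _ => V₀) π fun _ => U,
    Sum.inl none, fun y => Sum.inl (some y),
    fun _ _ h => Option.some_injective _ (Sum.inl_injective h), ?_, ?_, ?_⟩
  · intro i a
    have := hπ.glue_adj_of_adj (S := fun _ => U) (k := i) (hU a)
    rwa [hex, hel] at this
  · intro c hc i
    refine ⟨_, hc.comap (hπ.injective i) fun u v h => hπ.glue_adj_of_adj h, fun a => ?_⟩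
    simp only [Sym2.map_mk, hex, hel]
  · intro γ hγ
    choose c hc hcγ using hγ
    obtain ⟨C, hC, hC'⟩ := hπ.exists_good hH (J₀ := ∅) (by simp) hLF ∅ c
      (fun k => by simpa using hc k) (by
        have hx : ∀ i u v b, π i u = some none → π i v = some b → U.Adj u v →
            ∃ y, b = some y ∧ c i s(u, v) = γ y := by
          rintro i u v b hu hv huv
          rw [hπ_none i u hu] at huv ⊢
          rcases b with _ | y
          · exact (huv.ne (hπ_none i v hv).symm).elim
          · obtain ⟨a, rfl, rfl⟩ := hπ_some i v y hv
            exact ⟨_, rfl, hcγ i a⟩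
        rintro i l hil u v u' v' (_ | y) b' hu hu' hv hv' h h' -
        · obtain ⟨y, rfl, h1⟩ := hx i u v b' hu hv h
          obtain ⟨y', hy', h2⟩ := hx l u' v' _ hu' hv' h'
          rw [h1, h2, Option.some_injective _ hy']
        · rcases b' with _ | y'
          · obtain ⟨y, hy, h1⟩ := hx i v u _ hv hu h.symm
            obtain ⟨y', hy', h2⟩ := hx l v' u' _ hv' hu' h'.symm
            rw [Sym2.eq_swap, h1, Sym2.eq_swap, h2, Option.some_injective _ (hy.symm.trans hy')]
          · obtain ⟨a, rfl, ha⟩ := hπ_some i u _ hu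
            obtain ⟨a', rfl, ha'⟩ := hπ_some i v _ hv
            obtain ⟨β, rfl, hβ⟩ := hπ_some l u' _ hu'
            obtain ⟨β', rfl, hβ'⟩ := hπ_some l v' _ hv'
            exact (h.ne (congrArg leaf (hpair i l hil a a' β β' (ha.trans hβ.symm)
              (ha'.trans hβ'.symm)))).elim)
    refine ⟨C, by simpa using hC, fun i a => ?_⟩
    have := hC' i x₀ (leaf a) (hU a) (by simp)
    rw [hex, hel] at this
    rw [this, hcγ]

theorem RootedLeafFree.restrict {I A Y : Type} {f : I → A → Y} {n : ℕ} (h : RootedLeafFree f n)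
    (s : Finset I) : RootedLeafFree (fun i : s => f i) n := by
  intro J hJ hn y₀
  obtain ⟨i, hi, y, hy⟩ := h (J.map (Function.Embedding.subtype _)) (hJ.map) (by simpa using hn) y₀
  obtain ⟨i, hi', rfl⟩ := Finset.mem_map.1 hi
  refine ⟨i, hi', y, fun α hα => hy α (hα.imp id ?_)⟩
  rintro ⟨l, hl, hli, β, hβ⟩
  exact ⟨l, Finset.mem_map_of_mem _ hl, fun h => hli (Subtype.ext h), β, hβ⟩

theorem exists_perm_of_eq_iff {q : ℕ} {a b α β : Fin q} (h : a = b ↔ α = β) :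
    ∃ σ : Equiv.Perm (Fin q), σ a = α ∧ σ b = β := by
  by_cases hab : a = b
  · have := h.1 hab
    subst hab this
    exact ⟨Equiv.swap a α, Equiv.swap_apply_left _ _, Equiv.swap_apply_left _ _⟩
  · have hαβ : α ≠ β := fun h' => hab (h.2 h')
    refine ⟨(Equiv.swap a α).trans (Equiv.swap (Equiv.swap a α b) β), ?_, ?_⟩
    · rw [Equiv.trans_apply, Equiv.swap_apply_left, Equiv.swap_apply_of_ne_of_ne _ hαβ]
      intro h'
      have h2 : Equiv.swap a α a = Equiv.swap a α b := (Equiv.swap_apply_left _ _).trans h'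
      exact hab ((Equiv.swap a α).injective h2)
    · simp

/-- In the `H`-free colourings of `P`, the colours of `xy₁` and `xy₂` are equal if `r` is true and
different otherwise, and any such pair of colours occurs. -/
structure IsCherry {V W : Type} (q : ℕ) (H : SimpleGraph W) (r : Bool) (P : SimpleGraph V)
    (x y₁ y₂ : V) : Prop where
  ne : y₁ ≠ y₂
  adj₁ : P.Adj x y₁
  adj₂ : P.Adj x y₂
  eq_iff : ∀ c : Sym2 V → Fin q, Good H P c → (c s(x, y₁) = c s(x, y₂) ↔ r = true)
  exists_good : ∀ α β : Fin q, (α = β ↔ r = true) → ∃ c : Sym2 V → Fin q, Good H P c ∧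
    c s(x, y₁) = α ∧ c s(x, y₂) = β

theorem IsCherry.of_exists {V W : Type} [Fintype W] {q : ℕ} {H : SimpleGraph W}
    (hH : StrongConn H) {r : Bool} {P : SimpleGraph V} {x y₁ y₂ : V} (hne : y₁ ≠ y₂)
    (h₁ : P.Adj x y₁) (h₂ : P.Adj x y₂)
    (h : ∀ c : Sym2 V → Fin q, Good H P c → (c s(x, y₁) = c s(x, y₂) ↔ r = true))
    (hex : ∃ c : Sym2 V → Fin q, Good H P c) : IsCherry q H r P x y₁ y₂ := by
  refine ⟨hne, h₁, h₂, h, fun α β hαβ => ?_⟩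
  obtain ⟨c, hc⟩ := hex
  obtain ⟨σ, h1, h2⟩ := exists_perm_of_eq_iff ((h c hc).trans hαβ.symm)
  exact ⟨_, hc.perm hH σ.injective, h1, h2⟩

theorem exists_cherry_ne {q : ℕ} [NeZero q] (hq : 2 ≤ q) {W : Type} [Fintype W]
    {H : SimpleGraph W} (hH : StrongConn H) :
    ∃ (V : Type) (_ : Finite V) (P : SimpleGraph V) (x y₁ y₂ : V),
      IsCherry q H false P x y₁ y₂ := by
  classical
  obtain ⟨V₀, _, U, x₀, A, hU, ⟨c₀, hc₀⟩, hconst⟩ := exists_star hq hH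
  have hA : Nonempty A := by
    by_contra hA
    exact hconst c₀ hc₀ ⟨0, fun a ha => (hA ⟨a, ha⟩).elim⟩
  let leaf : A → V₀ := Subtype.val
  obtain ⟨I, Y, _, _, f₀, hf₀, hnc, hlf⟩ :=
    exists_leafFree_notColorable q (Fintype.card (W × W) + 2) A
  let s : Set (I × A → I × A) := {h | (∃ g : I × A → Y, ∀ i a, g (h (i, a)) = f₀ i a) ∧
    ∃ γ : I × A → Fin q, ∀ i, Extends H U x₀ leaf fun a => γ (h (i, a))}
  have hs : s.Nonempty := ⟨id, ⟨fun z => f₀ z.1 z.2, fun _ _ => rfl⟩,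
    fun z => c₀ s(x₀, z.2), fun _ => ⟨c₀, hc₀, fun _ => rfl⟩⟩
  obtain ⟨h, ⟨⟨g, hg⟩, γ₀, hγ₀⟩, hmin⟩ := Set.exists_min_image s (fun h => (Set.range h).ncard)
    (Set.toFinite _) hs
  obtain ⟨z₁, z₂, hz, hgz⟩ : ∃ z₁ z₂, h z₁ ≠ h z₂ ∧ g (h z₁) = g (h z₂) := by
    by_contra! hcon
    obtain ⟨i, k, hk⟩ := hnc fun y => if hy : ∃ z, g (h z) = y then γ₀ (h hy.choose) else 0
    have hγk : ∀ a, γ₀ (h (i, a)) = k := by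
      intro a
      have hy : ∃ z, g (h z) = f₀ i a := ⟨(i, a), hg i a⟩
      have h1 := hk a
      rw [dif_pos hy] at h1
      rw [← h1]
      by_contra hne
      exact hcon (i, a) hy.choose (fun h' => hne (congrArg γ₀ h'))
        ((hg i a).trans hy.choose_spec.symm)
    obtain ⟨c, hc, hc'⟩ := hγ₀ i
    exact hconst c hc ⟨k, fun a ha => (hc' ⟨a, ha⟩).trans (hγk _)⟩
  let m : I × A → I × A := Function.update id (h z₂) (h z₁)
  have hm : ∀ {B : Type} (φ : I × A → B), φ (h z₁) = φ (h z₂) → ∀ z, φ (m z) = φ z := by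
    intro B φ hφ z
    by_cases hz2 : z = h z₂
    · rw [hz2, ← hφ]
      simp [m]
    · simp [m, Function.update_of_ne hz2]
  have key : ∀ γ : I × A → Fin q, (∀ i, Extends H U x₀ leaf fun a => γ (h (i, a))) →
      γ (h z₁) ≠ γ (h z₂) := by
    intro γ hγ heq
    have hms : (fun z => m (h z)) ∈ s :=
      ⟨⟨g, fun i a => (hm g hgz _).trans (hg i a)⟩, γ, fun i => by
        simpa only [hm γ heq] using hγ i⟩
    refine absurd (hmin _ hms) (not_le.2 (Set.ncard_lt_ncard ?_ (Set.toFinite _)))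
    refine Set.ssubset_iff_of_subset ?_ |>.2 ⟨h z₂, ⟨z₂, rfl⟩, ?_⟩
    · rintro _ ⟨z, rfl⟩
      by_cases hz2 : h z = h z₂
      · exact ⟨z₁, by simp [m, hz2]⟩
      · exact ⟨z, by simp [m, Function.update_of_ne hz2]⟩
    · rintro ⟨z, hz'⟩
      by_cases hz2 : h z = h z₂
      · simp only [m, hz2, Function.update_self] at hz'
        exact hz hz'
      · simp only [m, Function.update_of_ne hz2, id] at hz'
        exact hz2 hz'
  have hgf : (fun i a => g (h (i, a))) = f₀ := by
    funext i a
    exact hg i a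
  have hinj : ∀ i, Function.Injective fun a => g (h (i, a)) := fun i => by
    have := hf₀ i
    rwa [← hgf] at this
  obtain ⟨V, _, P, x, y, hy, hadj, h1, h2⟩ :=
    exists_cone (q := q) hH (U := U) (x₀ := x₀) (leaf := leaf)
    Subtype.val_injective (fun a => hU a a.2) (f := fun i a => h (i, a))
    (fun i a b hab => hinj i (congrArg g hab))
    (RootedLeafFree.of_comp (g := g) (by rw [hgf]; exact hlf) hinj)
  refine ⟨V, ‹_›, P, x, y (h z₁), y (h z₂), IsCherry.of_exists hH (hy.ne hz) (hadj z₁.1 z₁.2)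
    (hadj z₂.1 z₂.2) (fun c hc => ?_) ?_⟩
  · simpa using key (fun z => c s(x, y z)) (h1 c hc)
  · obtain ⟨c, hc, -⟩ := h2 γ₀ hγ₀
    exact ⟨c, hc⟩

theorem exists_cherry_eq {q : ℕ} [NeZero q] (hq : 2 ≤ q) {W : Type} [Fintype W]
    {H : SimpleGraph W} (hH : StrongConn H) :
    ∃ (V : Type) (_ : Finite V) (P : SimpleGraph V) (x y₁ y₂ : V),
      IsCherry q H true P x y₁ y₂ := by
  classical
  obtain ⟨V₀, _, U, x₀, w₁, w₂, hU⟩ := exists_cherry_ne hq hH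
  let leaf : Bool → V₀ := fun b => cond b w₁ w₂
  have hleaf : leaf.Injective := by
    rintro (_ | _) (_ | _) h
    · rfl
    · exact (hU.ne h.symm).elim
    · exact (hU.ne h).elim
    · rfl
  have hext : ∀ p : Bool → Fin q, Extends H U x₀ leaf p ↔ p true ≠ p false := by
    intro p
    constructor
    · rintro ⟨c, hc, hcp⟩ h
      have h1 := (hU.eq_iff c hc).1 ((hcp true).trans (h.trans (hcp false).symm))
      cases h1
    · intro h
      obtain ⟨c, hc, h1, h2⟩ := hU.exists_good (p true) (p false) (by simpa using h)
      exact ⟨c, hc, fun b => by cases b <;> assumption⟩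
  obtain ⟨I, Y, _, _, f, hf, hnc, hlf⟩ :=
    exists_leafFree_notColorable q (Fintype.card (W × W) + 2) Bool
  let Sat : Finset I → Prop := fun s => ∃ γ : Y → Fin q, ∀ i ∈ s, γ (f i true) ≠ γ (f i false)
  obtain ⟨i₀, s, -, ⟨γ₀, hγ₀⟩, hns⟩ : ∃ i s, i ∉ s ∧ Sat s ∧ ¬ Sat (insert i s) := by
    by_contra! hcon
    have := Fintype.ofFinite I
    obtain ⟨γ, hγ⟩ := Finset.induction (motive := Sat) ⟨fun _ => 0, by simp⟩
      (fun i s hi hs => hcon i s hi hs) Finset.univ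
    obtain ⟨i, k, hk⟩ := hnc γ
    exact hγ i (Finset.mem_univ _) ((hk _).trans (hk _).symm)
  obtain ⟨V, _, P, x, y, hy, -, h1, h2⟩ := exists_cone (q := q) hH hleaf (U := U) (x₀ := x₀)
    (fun b => by cases b; exacts [hU.adj₂, hU.adj₁]) (f := fun i : s => f i)
    (fun i => hf i) (hlf.restrict s)
  have hne : f i₀ true ≠ f i₀ false := fun h => by cases hf i₀ h
  have key : ∀ c : Sym2 V → Fin q, Good H P c →
      c s(x, y (f i₀ true)) = c s(x, y (f i₀ false)) := by
    intro c hc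
    by_contra h
    refine hns ⟨fun z => c s(x, y z), fun i hi => ?_⟩
    rcases Finset.mem_insert.1 hi with rfl | hi
    · exact h
    · exact (hext _).1 (h1 c hc ⟨i, hi⟩)
  obtain ⟨c₀, hc₀, -⟩ := h2 γ₀ fun i => (hext _).2 (hγ₀ i i.2)
  have hadj : ∀ b, P.Adj x (y (f i₀ b)) := by
    intro b
    by_contra hb
    have : Nontrivial (Fin q) := Fin.nontrivial_iff_two_le.2 hq
    obtain ⟨j, hj⟩ := exists_ne (c₀ s(x, y (f i₀ b)))
    have hc := hc₀.congr (F := P) (c' := Function.update c₀ s(x, y (f i₀ b)) j)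
      (fun _ _ h => h) fun u v huv => by
        refine Function.update_of_ne (fun h => hb ?_) _ _
        rw [← mem_edgeSet, ← h]
        exact huv
    have h3 := key _ hc
    have h4 := key _ hc₀
    have hne' : s(x, y (f i₀ true)) ≠ s(x, y (f i₀ false)) :=
      fun h => hne (hy (Sym2.congr_right.1 h))
    cases b
    · rw [Function.update_self, Function.update_of_ne hne'] at h3
      exact hj (h3.symm.trans h4)
    · rw [Function.update_self, Function.update_of_ne hne'.symm] at h3
      exact hj (h3.trans h4.symm)
  exact ⟨V, ‹_›, P, x, y (f i₀ true), y (f i₀ false), IsCherry.of_exists hH (hy.ne hne)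
    (hadj _) (hadj _) (fun c hc => by simpa using key c hc) ⟨c₀, hc₀⟩⟩

theorem exists_cherry {q : ℕ} [NeZero q] (hq : 2 ≤ q) {W : Type} [Fintype W]
    {H : SimpleGraph W} (hH : StrongConn H) (r : Bool) :
    ∃ (V : Type) (_ : Finite V) (P : SimpleGraph V) (x y₁ y₂ : V),
      IsCherry q H r P x y₁ y₂ := by
  cases r
  · exact exists_cherry_ne hq hH
  · exact exists_cherry_eq hq hH

section Chain

variable {VZ I : Type} (L : ℕ) (e f : I → VZ × VZ)

/-- The `j`-th vertex of a path whose first edge is `e i`, whose last edge is `f i`, and whose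
other vertices are new. -/
def chainNode (i : I) (j : ℕ) : VZ ⊕ (I × Fin L) :=
  if h : 2 ≤ j ∧ j < L then Sum.inr (i, ⟨j, h.2⟩)
  else Sum.inl (if j = 0 then (e i).1 else if j < L then (e i).2 else if j = L then (f i).1
    else (f i).2)

variable {L e f}

theorem chainNode_eq_inr {i : I} {j : ℕ} (h2 : 2 ≤ j) (hL : j < L) :
    chainNode L e f i j = Sum.inr (i, ⟨j, hL⟩) :=
  dif_pos ⟨h2, hL⟩

theorem eq_of_chainNode_eq {i i' : I} {j j' : ℕ} (h2 : 2 ≤ j) (hL : j < L)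
    (h : chainNode L e f i j = chainNode L e f i' j') : i = i' ∧ j = j' := by
  rw [chainNode_eq_inr h2 hL] at h
  by_cases h' : 2 ≤ j' ∧ j' < L
  · rw [chainNode_eq_inr h'.1 h'.2] at h
    have := Sum.inr_injective h
    simpa using this
  · rw [chainNode, dif_neg h'] at h
    cases h

theorem chainNode_zero (i : I) : chainNode L e f i 0 = Sum.inl (e i).1 := by
  simp [chainNode]

theorem chainNode_one (hL : 2 ≤ L) (i : I) : chainNode L e f i 1 = Sum.inl (e i).2 := by
  simp [chainNode, show 1 < L by omega]

theorem chainNode_last (hL : 2 ≤ L) (i : I) : chainNode L e f i L = Sum.inl (f i).1 := by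
  simp [chainNode, show L ≠ 0 by omega]

theorem chainNode_succ_last (i : I) :
    chainNode L e f i (L + 1) = Sum.inl (f i).2 := by
  simp [chainNode]

theorem chainNode_injOn (hL : 8 ≤ L) (he : ∀ i, (e i).1 ≠ (e i).2) (hf : ∀ i, (f i).1 ≠ (f i).2)
    {i : I} {j j' : ℕ} (hj : j ≤ L + 1) (hj' : j' ≤ L + 1) (h1 : j ≤ j' + 4) (h2 : j' ≤ j + 4)
    (h : chainNode L e f i j = chainNode L e f i j') : j = j' := by
  by_cases hm : 2 ≤ j ∧ j < L
  · exact (eq_of_chainNode_eq hm.1 hm.2 h).2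
  by_cases hm' : 2 ≤ j' ∧ j' < L
  · exact (eq_of_chainNode_eq hm'.1 hm'.2 h.symm).2.symm
  by_contra hne
  have h01 : chainNode L e f i 0 ≠ chainNode L e f i 1 := by
    rw [chainNode_zero, chainNode_one (by omega)]
    exact fun h => he i (Sum.inl_injective h)
  have hll : chainNode L e f i L ≠ chainNode L e f i (L + 1) := by
    rw [chainNode_last (by omega), chainNode_succ_last]
    exact fun h => hf i (Sum.inl_injective h)
  have : (j = 0 ∧ j' = 1) ∨ (j = 1 ∧ j' = 0) ∨ (j = L ∧ j' = L + 1) ∨ (j = L + 1 ∧ j' = L) := by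
    omega
  rcases this with ⟨rfl, rfl⟩ | ⟨rfl, rfl⟩ | ⟨rfl, rfl⟩ | ⟨rfl, rfl⟩
  exacts [h01 h, h01 h.symm, hll h, hll h.symm]

variable {V : Bool → Type} (L e f) (r : I → Bool) (x y₁ y₂ : ∀ b, V b)

/-- The type of the links of the chains: the first one carries the relation `r`, the others carry
equality. -/
def linkRel (p : I × Fin L) : Bool :=
  if (p.2 : ℕ) = 0 then r p.1 else true

open Classical in
/-- The placement of the base graph and of the links of the chains. -/
noncomputable def chainPlace :
    ∀ k : Option (I × Fin L), k.elim VZ (fun p => V (linkRel L r p)) → Option (VZ ⊕ (I × Fin L))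
  | none => fun z => some (Sum.inl z)
  | some p => fun v =>
    if v = y₁ _ then some (chainNode L e f p.1 p.2) else
      if v = x _ then some (chainNode L e f p.1 (p.2 + 1)) else
        if v = y₂ _ then some (chainNode L e f p.1 (p.2 + 2)) else none

variable {L e f r x y₁ y₂}

theorem chainPlace_some {p : I × Fin L} {v : V (linkRel L r p)} {b : VZ ⊕ (I × Fin L)}
    (h : chainPlace L e f r x y₁ y₂ (some p) v = some b) :
    ∃ j, (p.2 : ℕ) ≤ j ∧ j ≤ p.2 + 2 ∧ b = chainNode L e f p.1 j ∧
      (j = p.2 → v = y₁ _) ∧ (j = p.2 + 1 → v = x _) ∧ (j = p.2 + 2 → v = y₂ _) := by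
  simp only [chainPlace] at h
  split_ifs at h with h1 h2 h3
  · exact ⟨p.2, le_rfl, by omega, (Option.some_injective _ h).symm, fun _ => h1, by omega, by omega⟩
  · exact ⟨p.2 + 1, by omega, by omega, (Option.some_injective _ h).symm, by omega, fun _ => h2,
      by omega⟩
  · exact ⟨p.2 + 2, by omega, by omega, (Option.some_injective _ h).symm, by omega, by omega,
      fun _ => h3⟩

theorem chainPlace_y₁ (p : I × Fin L) :
    chainPlace L e f r x y₁ y₂ (some p) (y₁ _) = some (chainNode L e f p.1 p.2) := by
  simp [chainPlace]

theorem chainPlace_x (h : ∀ b, x b ≠ y₁ b) (p : I × Fin L) :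
    chainPlace L e f r x y₁ y₂ (some p) (x _) = some (chainNode L e f p.1 (p.2 + 1)) := by
  simp [chainPlace, h]

theorem chainPlace_y₂ (h₁ : ∀ b, y₁ b ≠ y₂ b) (h : ∀ b, x b ≠ y₂ b) (p : I × Fin L) :
    chainPlace L e f r x y₁ y₂ (some p) (y₂ _) = some (chainNode L e f p.1 (p.2 + 2)) := by
  simp [chainPlace, (h _).symm, (h₁ _).symm]

theorem glueEmb_y₁ (p : I × Fin L) : glueEmb (chainPlace L e f r x y₁ y₂) (some p) (y₁ _) =
    Sum.inl (chainNode L e f p.1 p.2) :=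
  glueEmb_of_some (π := chainPlace L e f r x y₁ y₂) (k := some p) (chainPlace_y₁ p)

theorem glueEmb_x (h : ∀ b, x b ≠ y₁ b) (p : I × Fin L) :
    glueEmb (chainPlace L e f r x y₁ y₂) (some p) (x _) =
      Sum.inl (chainNode L e f p.1 (p.2 + 1)) :=
  glueEmb_of_some (π := chainPlace L e f r x y₁ y₂) (k := some p) (chainPlace_x h p)

theorem glueEmb_y₂ (h₁ : ∀ b, y₁ b ≠ y₂ b) (h : ∀ b, x b ≠ y₂ b) (p : I × Fin L) :
    glueEmb (chainPlace L e f r x y₁ y₂) (some p) (y₂ _) =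
      Sum.inl (chainNode L e f p.1 (p.2 + 2)) :=
  glueEmb_of_some (π := chainPlace L e f r x y₁ y₂) (k := some p) (chainPlace_y₂ h₁ h p)

theorem placedInj_chainPlace (hL : 8 ≤ L) (he : ∀ i, (e i).1 ≠ (e i).2)
    (hf : ∀ i, (f i).1 ≠ (f i).2) : PlacedInj (chainPlace L e f r x y₁ y₂) := by
  rintro (_ | p) u v b hu hv
  · exact Sum.inl_injective (Option.some_injective _ (hu.trans hv.symm))
  · obtain ⟨j, h1, h2, rfl, h3⟩ := chainPlace_some hu
    obtain ⟨j', h1', h2', hj, h3'⟩ := chainPlace_some hv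
    have hp := p.2.2
    obtain rfl := chainNode_injOn hL he hf (by omega) (by omega) (by omega) (by omega) hj
    have : j = p.2 ∨ j = p.2 + 1 ∨ j = p.2 + 2 := by omega
    rcases this with h | h | h
    · rw [h3.1 h, h3'.1 h]
    · rw [h3.2.1 h, h3'.2.1 h]
    · rw [h3.2.2 h, h3'.2.2 h]

/-- The pieces glued along the chains. -/
def chainPiece (Z : SimpleGraph VZ) (P : ∀ b, SimpleGraph (V b)) :
    ∀ k : Option (I × Fin L), SimpleGraph (k.elim VZ (fun p => V (linkRel L r p)))
  | none => Z
  | some p => P (linkRel L r p)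

variable {Z : SimpleGraph VZ} {P : ∀ b, SimpleGraph (V b)}

theorem leafFree_chain {n : ℕ} (hLn : 2 * n + 8 ≤ L) (he : ∀ i, Z.Adj (e i).1 (e i).2)
    (hf : ∀ i, Z.Adj (f i).1 (f i).2) (hne : ∀ b, y₁ b ≠ y₂ b) (h₁ : ∀ b, (P b).Adj (x b) (y₁ b))
    (h₂ : ∀ b, (P b).Adj (x b) (y₂ b)) :
    LeafFree (gluePiece (chainPlace L e f r x y₁ y₂) (chainPiece Z P)) {none} n := by
  classical
  intro J hJ₀ _ hn
  have hnone : none ∈ J := hJ₀ (Finset.mem_singleton_self _)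
  by_cases hJ : J = {none}
  · exact Or.inl ⟨_, hJ⟩
  right
  have hπ : PlacedInj (chainPlace L e f r x y₁ y₂) :=
    placedInj_chainPlace (by omega) (fun i => (he i).ne) fun i => (hf i).ne
  have hg₁ : ∀ p : I × Fin L, (gluePiece (chainPlace L e f r x y₁ y₂) (chainPiece Z P) (some p)).Adj
      (Sum.inl (chainNode L e f p.1 p.2)) (Sum.inl (chainNode L e f p.1 (p.2 + 1))) := by
    intro p
    rw [← glueEmb_y₁ (r := r) (x := x) (y₂ := y₂) p, ← glueEmb_x (fun b => (h₁ b).ne) p]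
    exact hπ.gluePiece_adj.2 (h₁ _).symm
  have hg₂ : ∀ p : I × Fin L, (gluePiece (chainPlace L e f r x y₁ y₂) (chainPiece Z P) (some p)).Adj
      (Sum.inl (chainNode L e f p.1 (p.2 + 1))) (Sum.inl (chainNode L e f p.1 (p.2 + 2))) := by
    intro p
    rw [← glueEmb_x (r := r) (y₂ := y₂) (fun b => (h₁ b).ne) p,
      ← glueEmb_y₂ hne (fun b => (h₂ b).ne) p]
    exact hπ.gluePiece_adj.2 (h₂ _)
  have hgZ : ∀ z z', Z.Adj z z' → (gluePiece (chainPlace L e f r x y₁ y₂) (chainPiece Z P)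
      none).Adj (Sum.inl (Sum.inl z)) (Sum.inl (Sum.inl z')) := by
    intro z z' h
    have := hπ.gluePiece_adj (S := chainPiece Z P) (k := none) (u := z) (v := z')
    exact this.2 h
  -- The vertices that a link shares with the other members of `J`.
  have hsh : ∀ (i : I) (m : Fin L), ∀ w,
      (∃ z, (gluePiece (chainPlace L e f r x y₁ y₂) (chainPiece Z P) (some (i, m))).Adj w z) →
      (∃ z, ∃ l ∈ J, l ≠ some (i, m) ∧
        (gluePiece (chainPlace L e f r x y₁ y₂) (chainPiece Z P) l).Adj w z) →
      ∃ j, (m : ℕ) ≤ j ∧ j ≤ m + 2 ∧ w = Sum.inl (chainNode L e f i j) ∧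
        (2 ≤ j → j < L → ∃ m' : Fin L, some (i, m') ∈ J ∧ m' ≠ m ∧ (m' : ℕ) ≤ j ∧ j ≤ m' + 2) := by
    rintro i m w hw ⟨z, l, hl, hli, hz⟩
    obtain ⟨b, u, v, rfl, hu, hv⟩ := exists_of_support hli.symm hw ⟨z, hz⟩
    obtain ⟨j, hj1, hj2, rfl, -⟩ := chainPlace_some hu
    refine ⟨j, hj1, hj2, rfl, fun h2 hL => ?_⟩
    rcases l with _ | ⟨i', m'⟩
    · have hv' := Option.some_injective _ hv
      rw [chainNode_eq_inr h2 hL] at hv'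
      cases hv'
    · obtain ⟨j', hj1', hj2', hjj, -⟩ := chainPlace_some hv
      obtain ⟨rfl, rfl⟩ := eq_of_chainNode_eq h2 hL hjj
      exact ⟨m', hl, fun h => hli (by rw [h]), hj1', hj2'⟩
  obtain ⟨i, m₀, hm₀⟩ : ∃ i m, some (i, m) ∈ J := by
    by_contra! hcon
    refine hJ (Finset.eq_singleton_iff_unique_mem.2 ⟨hnone, ?_⟩)
    rintro (_ | ⟨i, m⟩) h
    · rfl
    · exact (hcon i m h).elim
  obtain ⟨w, hwL, hw⟩ : ∃ w, w + 1 < L ∧ ∀ m : Fin L, some (i, m) ∈ J →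
      (m : ℕ) ≠ w ∧ (m : ℕ) ≠ w + 1 := by
    by_contra! hcon
    have := Finset.card_le_card_of_surjOn (s := J) (t := Finset.range (n + 1))
      (fun k => k.elim 0 fun p => (p.2 : ℕ) / 2) (by
        intro a ha
        rw [Finset.coe_range, Set.mem_Iio] at ha
        obtain ⟨m, hm, hm'⟩ := hcon (2 * a) (by omega)
        refine ⟨_, hm, ?_⟩
        change (m : ℕ) / 2 = a
        omega)
    rw [Finset.card_range] at this
    omega
  have hm₀w := hw m₀ hm₀
  rcases lt_or_gt_of_ne hm₀w.1 with hlt | hgt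
  · obtain ⟨m, hm, hmax⟩ := Finset.exists_max_image
      (Finset.univ.filter fun m : Fin L => some (i, m) ∈ J ∧ (m : ℕ) < w) (fun m => (m : ℕ))
      ⟨m₀, by simp [hm₀, hlt]⟩
    rw [Finset.mem_filter] at hm
    obtain ⟨-, hm, hmw⟩ := hm
    have hmax' : ∀ m' : Fin L, some (i, m') ∈ J → (m' : ℕ) ≤ w + 1 → (m' : ℕ) ≤ m := by
      intro m' hm' hle
      have := hw m' hm'
      exact hmax m' (by rw [Finset.mem_filter]; exact ⟨Finset.mem_univ _, hm', by omega⟩)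
    refine ⟨some (i, m), hm, by simp, ?_⟩
    by_cases hprev : (m : ℕ) = 0 ∨ ∃ m' : Fin L, some (i, m') ∈ J ∧ (m' : ℕ) + 1 = m
    · refine ⟨Sum.inl (chainNode L e f i m), Sum.inl (chainNode L e f i (m + 1)), ?_,
        iff_of_true (hg₁ (i, m)) ?_⟩
      · intro w' hw1 hw2
        obtain ⟨j, h1, h2, rfl, h3⟩ := hsh i m w' hw1 hw2
        have : j = m ∨ j = m + 1 ∨ j = m + 2 := by omega
        rcases this with rfl | rfl | rfl
        · exact Or.inl rfl
        · exact Or.inr rfl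
        · obtain ⟨m', hm', hne', h4, h5⟩ := h3 (by omega) (by omega)
          have := hmax' m' hm' (by omega)
          have := Fin.val_ne_of_ne hne'
          omega
      · rcases hprev with h0 | ⟨m', hm', h0⟩
        · refine ⟨none, hnone, by simp, ?_⟩
          rw [h0, chainNode_zero, zero_add, chainNode_one (by omega)]
          exact hgZ _ _ (he i)
        · refine ⟨some (i, m'), hm', fun h => ?_, ?_⟩
          · simp only [Option.some.injEq, Prod.mk.injEq, true_and] at h
            rw [h] at h0
            omega
          · have := hg₂ (i, m')
            rwa [← h0]
    · push Not at hprev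
      refine ⟨Sum.inl (chainNode L e f i m), Sum.inl (chainNode L e f i m), ?_,
        iff_of_false (SimpleGraph.irrefl _) fun ⟨_, _, _, h⟩ => h.ne rfl⟩
      intro w' hw1 hw2
      obtain ⟨j, h1, h2, rfl, h3⟩ := hsh i m w' hw1 hw2
      by_cases hj : j = m
      · rw [hj]
        exact Or.inl rfl
      obtain ⟨m', hm', hne', h4, h5⟩ := h3 (by omega) (by omega)
      have := hmax' m' hm' (by omega)
      have := Fin.val_ne_of_ne hne'
      have := hprev.2 m' hm'
      omega
  · obtain ⟨m, hm, hmin⟩ := Finset.exists_min_image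
      (Finset.univ.filter fun m : Fin L => some (i, m) ∈ J ∧ w < (m : ℕ)) (fun m => (m : ℕ))
      ⟨m₀, by simp [hm₀, hgt]⟩
    rw [Finset.mem_filter] at hm
    obtain ⟨-, hm, hmw⟩ := hm
    have hmin' : ∀ m' : Fin L, some (i, m') ∈ J → w ≤ (m' : ℕ) → (m : ℕ) ≤ m' := by
      intro m' hm' hle
      have := hw m' hm'
      exact hmin m' (by rw [Finset.mem_filter]; exact ⟨Finset.mem_univ _, hm', by omega⟩)
    have hmw' := hw m hm
    have hmL := m.2
    refine ⟨some (i, m), hm, by simp, ?_⟩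
    by_cases hnext : (m : ℕ) + 1 = L ∨ ∃ m' : Fin L, some (i, m') ∈ J ∧ (m' : ℕ) = m + 1
    · refine ⟨Sum.inl (chainNode L e f i (m + 1)), Sum.inl (chainNode L e f i (m + 2)), ?_,
        iff_of_true (hg₂ (i, m)) ?_⟩
      · intro w' hw1 hw2
        clear hnext
        obtain ⟨j, h1, h2, rfl, h3⟩ := hsh i m w' hw1 hw2
        have : j = m ∨ j = m + 1 ∨ j = m + 2 := by omega
        rcases this with rfl | rfl | rfl
        · obtain ⟨m', hm', hne', h4, h5⟩ := h3 (by omega) (by omega)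
          have := hmin' m' hm' (by omega)
          have := Fin.val_ne_of_ne hne'
          omega
        · exact Or.inl rfl
        · exact Or.inr rfl
      · rcases hnext with h0 | ⟨m', hm', h0⟩
        · refine ⟨none, hnone, by simp, ?_⟩
          rw [show (m : ℕ) + 2 = L + 1 by omega, h0, chainNode_last (by omega),
            chainNode_succ_last]
          exact hgZ _ _ (hf i)
        · refine ⟨some (i, m'), hm', fun h => ?_, ?_⟩
          · simp only [Option.some.injEq, Prod.mk.injEq, true_and] at h
            rw [h] at h0
            omega
          · have := hg₁ (i, m')
            simp only [h0] at this
            exact this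
    · push Not at hnext
      refine ⟨Sum.inl (chainNode L e f i (m + 2)), Sum.inl (chainNode L e f i (m + 2)), ?_,
        iff_of_false (SimpleGraph.irrefl _) fun ⟨_, _, _, h⟩ => h.ne rfl⟩
      intro w' hw1 hw2
      obtain ⟨j, h1, h2, rfl, h3⟩ := hsh i m w' hw1 hw2
      by_cases hj : j = m + 2
      · rw [hj]
        exact Or.inl rfl
      obtain ⟨m', hm', hne', h4, h5⟩ := h3 (by omega) (by omega)
      have := hmin' m' hm' (by omega)
      have := Fin.val_ne_of_ne hne'
      have := hnext.2 m' hm'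
      omega

end Chain

section Chain

variable {VZ I : Type} {L : ℕ} {e f : I → VZ × VZ} {V : Bool → Type} {r : I → Bool}
  {x y₁ y₂ : ∀ b, V b} {Z : SimpleGraph VZ} {P : ∀ b, SimpleGraph (V b)} {q : ℕ}

/-- The colours of the edges between placed vertices: those of the base graph are coloured by `c`,
and `g i j` is the colour of the `j`-th edge of the `i`-th chain. -/
theorem chain_color_eq (hL : 8 ≤ L) (D : Set (Sym2 VZ)) (c : Sym2 VZ → Fin q)
    (g : I → ℕ → Fin q)
    (hge : ∀ i, s((e i).1, (e i).2) ∉ D → g i 0 = c s((e i).1, (e i).2))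
    (hgf : ∀ i, s((f i).1, (f i).2) ∉ D → g i L = c s((f i).1, (f i).2))
    (C : ∀ p : I × Fin L, Sym2 (V (linkRel L r p)) → Fin q)
    (hC₁ : ∀ p, C p s(x _, y₁ _) = g p.1 p.2) (hC₂ : ∀ p, C p s(x _, y₂ _) = g p.1 (p.2 + 1))
    {p : I × Fin L} {u v : V (linkRel L r p)} {b b' : VZ ⊕ (I × Fin L)} (huv : u ≠ v)
    (hu : chainPlace L e f r x y₁ y₂ (some p) u = some b)
    (hv : chainPlace L e f r x y₁ y₂ (some p) v = some b') :
    (∃ z z', b = Sum.inl z ∧ b' = Sum.inl z' ∧ (s(z, z') ∉ D → C p s(u, v) = c s(z, z'))) ∨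
    ∃ j j', b = chainNode L e f p.1 j ∧ b' = chainNode L e f p.1 j' ∧ (p.2 : ℕ) ≤ j ∧
      j ≤ p.2 + 2 ∧ (p.2 : ℕ) ≤ j' ∧ j' ≤ p.2 + 2 ∧ j ≠ j' ∧ ((2 ≤ j ∧ j < L) ∨ 2 ≤ j' ∧ j' < L) ∧
      (j' ≤ j + 1 → j ≤ j' + 1 → C p s(u, v) = g p.1 (min j j')) := by
  obtain ⟨j, h1, h2, rfl, h3⟩ := chainPlace_some hu
  obtain ⟨j', h1', h2', rfl, h3'⟩ := chainPlace_some hv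
  have hp := p.2.2
  have hjj : j ≠ j' := by
    rintro rfl
    have : j = p.2 ∨ j = p.2 + 1 ∨ j = p.2 + 2 := by omega
    rcases this with h | h | h
    · exact huv ((h3.1 h).trans (h3'.1 h).symm)
    · exact huv ((h3.2.1 h).trans (h3'.2.1 h).symm)
    · exact huv ((h3.2.2 h).trans (h3'.2.2 h).symm)
  have hcol : j' ≤ j + 1 → j ≤ j' + 1 → C p s(u, v) = g p.1 (min j j') := by
    intro h4 h5
    have : (j = p.2 ∧ j' = p.2 + 1) ∨ (j = p.2 + 1 ∧ j' = p.2 + 2) ∨ (j' = p.2 ∧ j = p.2 + 1) ∨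
      (j' = p.2 + 1 ∧ j = p.2 + 2) := by omega
    rcases this with ⟨h, h'⟩ | ⟨h, h'⟩ | ⟨h, h'⟩ | ⟨h, h'⟩
    · rw [h3.1 h, h3'.2.1 h', Sym2.eq_swap, hC₁, min_eq_left (by omega), h]
    · rw [h3.2.1 h, h3'.2.2 h', hC₂, min_eq_left (by omega), h]
    · rw [h3.2.1 h', h3'.1 h, hC₁, min_eq_right (by omega), h]
    · rw [h3.2.2 h', h3'.2.1 h, Sym2.eq_swap, hC₂, min_eq_right (by omega), h]
  by_cases hmid : (2 ≤ j ∧ j < L) ∨ 2 ≤ j' ∧ j' < L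
  · exact Or.inr ⟨j, j', rfl, rfl, h1, h2, h1', h2', hjj, hmid, hcol⟩
  · left
    have : (j = 0 ∧ j' = 1) ∨ (j = 1 ∧ j' = 0) ∨ (j = L ∧ j' = L + 1) ∨ (j = L + 1 ∧ j' = L) := by
      omega
    have hc := hcol (by omega) (by omega)
    rcases this with ⟨rfl, rfl⟩ | ⟨rfl, rfl⟩ | ⟨rfl, rfl⟩ | ⟨rfl, rfl⟩
    · exact ⟨_, _, chainNode_zero _, chainNode_one (by omega) _, fun h => by
        rw [hc, ← hge _ h, min_eq_left (by omega)]⟩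
    · refine ⟨_, _, chainNode_one (by omega) _, chainNode_zero _, fun h => ?_⟩
      rw [Sym2.eq_swap] at h
      rw [hc, Sym2.eq_swap, ← hge _ h, min_eq_right (by omega)]
    · exact ⟨_, _, chainNode_last (by omega) _, chainNode_succ_last _, fun h => by
        rw [hc, ← hgf _ h, min_eq_left (by omega)]⟩
    · refine ⟨_, _, chainNode_succ_last _, chainNode_last (by omega) _, fun h => ?_⟩
      rw [Sym2.eq_swap] at h
      rw [hc, Sym2.eq_swap, ← hgf _ h, min_eq_right (by omega)]

theorem chain_exists_good [NeZero q] {W : Type} [Fintype W] {H : SimpleGraph W}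
    (hH : StrongConn H) (hLn : 2 * (Fintype.card (W × W) + 1) + 8 ≤ L)
    (hP : ∀ b, IsCherry q H b (P b) (x b) (y₁ b) (y₂ b))
    (he : ∀ i, Z.Adj (e i).1 (e i).2) (hf : ∀ i, Z.Adj (f i).1 (f i).2)
    (D : Set (Sym2 VZ)) (c : Sym2 VZ → Fin q) (hc : Good H (Z.deleteEdges D) c)
    (α β : I → Fin q) (hαβ : ∀ i, α i = β i ↔ r i = true)
    (hα : ∀ i, s((e i).1, (e i).2) ∉ D → α i = c s((e i).1, (e i).2))
    (hβ : ∀ i, s((f i).1, (f i).2) ∉ D → β i = c s((f i).1, (f i).2)) :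
    ∃ C, Good (q := q) H ((glue (chainPlace L e f r x y₁ y₂) (chainPiece Z P)).deleteEdges
      (Sym2.map (fun z => Sum.inl (Sum.inl z)) '' D)) C := by
  have hne : ∀ b, y₁ b ≠ y₂ b := fun b => (hP b).ne
  have hπ : PlacedInj (chainPlace L e f r x y₁ y₂) :=
    placedInj_chainPlace (by omega) (fun i => (he i).ne) fun i => (hf i).ne
  let g : I → ℕ → Fin q := fun i j => if j = 0 then α i else β i
  have hg : ∀ p : I × Fin L, g p.1 p.2 = g p.1 (p.2 + 1) ↔ linkRel L r p = true := by
    intro p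
    by_cases h : (p.2 : ℕ) = 0
    · simp [g, linkRel, h, hαβ]
    · simp [g, linkRel, h]
  choose C hC hC₁ hC₂ using fun p : I × Fin L => (hP (linkRel L r p)).exists_good _ _ (hg p)
  let c' : ∀ k : Option (I × Fin L), Sym2 (k.elim VZ fun p => V (linkRel L r p)) → Fin q
    | none => c
    | some p => C p
  have hD : ∀ z z', (s(Sum.inl (Sum.inl z), Sum.inl (Sum.inl z')) :
      Sym2 ((VZ ⊕ (I × Fin L)) ⊕ Σ k : Option (I × Fin L), k.elim VZ fun p => V (linkRel L r p))) ∉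
      Sym2.map (fun z => Sum.inl (Sum.inl z)) '' D → s(z, z') ∉ D :=
    fun z z' h h' => h ⟨_, h', rfl⟩
  have key := fun {p u v b b'} => chain_color_eq (x := x) (y₁ := y₁) (y₂ := y₂) (r := r) (p := p)
    (u := u) (v := v) (b := b) (b' := b') (by omega) D c g
    (fun i h => by rw [← hα i h]; simp [g])
    (fun i h => by rw [← hβ i h]; simp [g, show L ≠ 0 by omega]) C hC₁ hC₂
  obtain ⟨C', hC', -⟩ := hπ.exists_good (q := q) hH (J₀ := {none}) (by simp)
    (leafFree_chain (r := r) hLn he hf hne (fun b => (hP b).adj₁) fun b => (hP b).adj₂)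
    (Sym2.map (fun z => Sum.inl (Sum.inl z)) '' D) c' (by
      rintro (_ | p)
      · refine hc.mono ?_
        intro u v huv
        have huv' := deleteEdges_adj.1 huv
        exact deleteEdges_adj.2 ⟨huv'.1, fun h => huv'.2 ⟨_, h, rfl⟩⟩
      · exact (hC p).mono (deleteEdges_le _)) (by
      have hnone : ∀ p : I × Fin L, ∀ (u v : VZ) u' v' b b',
          chainPlace L e f r x y₁ y₂ none u = some b →
          chainPlace L e f r x y₁ y₂ (some p) u' = some b →
          chainPlace L e f r x y₁ y₂ none v = some b' →
          chainPlace L e f r x y₁ y₂ (some p) v' = some b' → u' ≠ v' → s(u, v) ∉ D →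
          c s(u, v) = C p s(u', v') := by
        intro p u v u' v' b b' hu hu' hv hv' h' hbD
        obtain rfl := Option.some_injective _ hu
        obtain rfl := Option.some_injective _ hv
        rcases key h' hu' hv' with ⟨z, z', hz, hz', h⟩ | ⟨j, j', hj, hj', -, -, -, -, -, h, -⟩
        · obtain rfl := Sum.inl_injective hz
          obtain rfl := Sum.inl_injective hz'
          exact (h hbD).symm
        · rcases h with h | h
          · rw [chainNode_eq_inr h.1 h.2] at hj
            cases hj
          · rw [chainNode_eq_inr h.1 h.2] at hj'
            cases hj'
      rintro (_ | p) (_ | p') hkl u v u' v' b b' hu hu' hv hv' h h' hbD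
      · exact (hkl rfl).elim
      · obtain rfl := Option.some_injective _ hu
        obtain rfl := Option.some_injective _ hv
        exact hnone _ _ _ _ _ _ _ hu hu' hv hv' h'.ne (hD _ _ hbD)
      · obtain rfl := Option.some_injective _ hu'
        obtain rfl := Option.some_injective _ hv'
        exact (hnone _ _ _ _ _ _ _ hu' hu hv' hv h.ne (hD _ _ hbD)).symm
      · rcases key h.ne hu hv with
            ⟨z, z', rfl, rfl, h1⟩ | ⟨j, j', rfl, rfl, a1, a2, a3, a4, a5, a6, a7⟩
        · rcases key h'.ne hu' hv' with
            ⟨w, w', hw, hw', h2⟩ | ⟨i, i', hi, hi', -, -, -, -, -, h2, -⟩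
          · obtain rfl := Sum.inl_injective hw
            obtain rfl := Sum.inl_injective hw'
            exact (h1 (hD _ _ hbD)).trans (h2 (hD _ _ hbD)).symm
          · rcases h2 with h2 | h2
            · rw [chainNode_eq_inr h2.1 h2.2] at hi
              cases hi
            · rw [chainNode_eq_inr h2.1 h2.2] at hi'
              cases hi'
        · rcases key h'.ne hu' hv' with
            ⟨w, w', hw, hw', h2⟩ | ⟨i, i', hi, hi', b1, b2, b3, b4, b5, b6, b7⟩
          · rcases a6 with a6 | a6
            · rw [chainNode_eq_inr a6.1 a6.2] at hw
              cases hw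
            · rw [chainNode_eq_inr a6.1 a6.2] at hw'
              cases hw'
          · obtain ⟨i₀, m⟩ := p
            obtain ⟨i₁, m'⟩ := p'
            have hm := m.2
            have hm' := m'.2
            simp only at *
            obtain ⟨rfl, hjj⟩ : i₀ = i₁ ∧ (j = i ∨ j' = i') := by
              rcases a6 with a6 | a6
              · exact (eq_of_chainNode_eq a6.1 a6.2 hi).imp id Or.inl
              · exact (eq_of_chainNode_eq a6.1 a6.2 hi').imp id Or.inr
            obtain rfl := chainNode_injOn (by omega) (fun i => (he i).ne) (fun i => (hf i).ne)
              (by omega) (by omega) (by omega) (by omega) hi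
            obtain rfl := chainNode_injOn (by omega) (fun i => (he i).ne) (fun i => (hf i).ne)
              (by omega) (by omega) (by omega) (by omega) hi'
            have hmm : (m : ℕ) ≠ m' := fun h => hkl (by rw [Fin.ext h])
            exact (a7 (by omega) (by omega)).trans (b7 (by omega) (by omega)).symm)
  exact ⟨C', hC'⟩

theorem Good.chain {W : Type} {H : SimpleGraph W} (hL : 8 ≤ L)
    (hP : ∀ b, IsCherry q H b (P b) (x b) (y₁ b) (y₂ b))
    (he : ∀ i, (e i).1 ≠ (e i).2) (hf : ∀ i, (f i).1 ≠ (f i).2)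
    {c} (hc : Good (q := q) H (glue (chainPlace L e f r x y₁ y₂) (chainPiece Z P)) c) (i : I) :
    c s(Sum.inl (Sum.inl (e i).1), Sum.inl (Sum.inl (e i).2)) =
      c s(Sum.inl (Sum.inl (f i).1), Sum.inl (Sum.inl (f i).2)) ↔ r i = true := by
  have hπ : PlacedInj (chainPlace L e f r x y₁ y₂) := placedInj_chainPlace hL he hf
  let a : ℕ → Fin q := fun j =>
    c s(Sum.inl (chainNode L e f i j), Sum.inl (chainNode L e f i (j + 1)))
  have hstep : ∀ m : Fin L, a m = a (m + 1) ↔ linkRel L r (i, m) = true := by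
    intro m
    have h := (hP _).eq_iff _ (hc.comap (S := P (linkRel L r (i, m))) (hπ.injective (some (i, m)))
      fun u v h => hπ.glue_adj_of_adj h)
    rw [← h]
    change _ ↔ c s(glueEmb _ (some (i, m)) (x _), glueEmb _ (some (i, m)) (y₁ _)) =
      c s(glueEmb _ (some (i, m)) (x _), glueEmb _ (some (i, m)) (y₂ _))
    rw [glueEmb_y₁, glueEmb_x fun b => (hP b).adj₁.ne,
      glueEmb_y₂ (fun b => (hP b).ne) fun b => (hP b).adj₂.ne, Sym2.eq_swap]
  have hall : ∀ j, 1 ≤ j → j ≤ L → a 1 = a j := by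
    intro j h1
    induction j, h1 using Nat.le_induction with
    | base => exact fun _ => rfl
    | succ j h1 ih =>
      intro hj
      rw [ih (by omega)]
      refine (hstep ⟨j, by omega⟩).2 ?_
      simp [linkRel, show j ≠ 0 by omega]
  have h0 := hstep ⟨0, by omega⟩
  simp only [linkRel, if_true, zero_add] at h0
  rw [hall L (by omega) le_rfl] at h0
  simp only [a, chainNode_zero, zero_add, chainNode_one (show 2 ≤ L by omega),
    chainNode_last (show 2 ≤ L by omega), chainNode_succ_last] at h0
  exact h0

end Chain

/-- Equalities and inequalities between the colours of edges of a graph `Z` can be imposed by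
embedding `Z` into a larger graph. -/
theorem exists_constrained {q : ℕ} [NeZero q] (hq : 2 ≤ q) {W : Type} [Fintype W]
    {H : SimpleGraph W} (hH : StrongConn H) {VZ : Type} [Finite VZ] (Z : SimpleGraph VZ)
    {I : Type} [Finite I] (e f : I → VZ × VZ) (r : I → Bool) (he : ∀ i, Z.Adj (e i).1 (e i).2)
    (hf : ∀ i, Z.Adj (f i).1 (f i).2) :
    ∃ (V : Type) (_ : Finite V) (F : SimpleGraph V) (ι : VZ → V), ι.Injective ∧
      (∀ u v, Z.Adj u v → F.Adj (ι u) (ι v)) ∧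
      (∀ c : Sym2 V → Fin q, Good H F c →
        ∀ i, c s(ι (e i).1, ι (e i).2) = c s(ι (f i).1, ι (f i).2) ↔ r i = true) ∧
      ∀ (D : Set (Sym2 VZ)) (c : Sym2 VZ → Fin q), Good H (Z.deleteEdges D) c →
        ∀ α β : I → Fin q, (∀ i, α i = β i ↔ r i = true) →
        (∀ i, s((e i).1, (e i).2) ∉ D → α i = c s((e i).1, (e i).2)) →
        (∀ i, s((f i).1, (f i).2) ∉ D → β i = c s((f i).1, (f i).2)) →
        ∃ C : Sym2 V → Fin q, Good H (F.deleteEdges (Sym2.map ι '' D)) C := by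
  choose V hV P x y₁ y₂ hP using exists_cherry (q := q) hq hH
  let L := 2 * (Fintype.card (W × W) + 1) + 8
  have hL : 8 ≤ L := by omega
  have hπ : PlacedInj (chainPlace L e f r x y₁ y₂) :=
    placedInj_chainPlace hL (fun i => (he i).ne) fun i => (hf i).ne
  have hfin : ∀ k : Option (I × Fin L), Finite (k.elim VZ fun p => V (linkRel L r p)) := by
    rintro (_ | p)
    · exact ‹Finite VZ›
    · exact hV _
  refine ⟨(VZ ⊕ (I × Fin L)) ⊕ Σ k : Option (I × Fin L), k.elim VZ fun p => V (linkRel L r p),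
    inferInstance, glue (chainPlace L e f r x y₁ y₂) (chainPiece Z P),
    fun z => Sum.inl (Sum.inl z), Sum.inl_injective.comp Sum.inl_injective, ?_,
    fun c hc => hc.chain hL hP (fun i => (he i).ne) fun i => (hf i).ne, ?_⟩
  · intro u v h
    exact hπ.glue_adj_of_adj (S := chainPiece Z P) (k := none) h
  · intro D c hc α β hαβ hα hβ
    exact chain_exists_good hH le_rfl hP he hf D c hc α β hαβ hα hβ

theorem good_self {W : Type} [Finite W] {q : ℕ} {H : SimpleGraph W} {c : Sym2 W → Fin q}
    (h : ∀ i, ∃ a b, H.Adj a b ∧ c s(a, b) ≠ i) : Good H H c := by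
  rintro ⟨i, f, hf⟩
  obtain ⟨a, b, hab, hne⟩ := h i
  let g : H.edgeSet → H.edgeSet := fun e => ⟨Sym2.map f e, by
    obtain ⟨e, he⟩ := e
    induction e with
    | _ u v => exact (hf u v he).1⟩
  have hg : g.Injective := fun e e' hee =>
    Subtype.ext (Sym2.map.injective f.injective (congrArg Subtype.val hee))
  obtain ⟨⟨e, he⟩, hee⟩ := Finite.surjective_of_injective hg ⟨s(a, b), hab⟩
  have h2 : Sym2.map f e = s(a, b) := congrArg Subtype.val hee
  rw [← h2] at hne
  induction e with
  | _ u v => exact hne (hf u v he).2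

theorem good_bool {W : Type} [Fintype W] {q : ℕ} {H : SimpleGraph W} (hH : StrongConn H)
    (c : Sym2 Bool → Fin q) : Good H ⊤ c := by
  rintro ⟨i, f, -⟩
  have := Fintype.card_le_of_embedding f
  have h3 := hH.1
  rw [Fintype.card_bool] at this
  omega

section Csp

variable {VG A Y K W : Type}

/-- The vertices of `G`, of an isolated edge for each variable, and of a copy of `H` for each
clause. -/
abbrev CspVert (VG Y K W : Type) : Option (Y ⊕ K) → Type
  | none => VG
  | some (Sum.inl _) => Bool
  | some (Sum.inr _) => W

/-- The graph `G`, an isolated edge for each variable, and a copy of `H` for each clause. -/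
def cspPiece (Y K : Type) (G : SimpleGraph VG) (H : SimpleGraph W) :
    ∀ k, SimpleGraph (CspVert VG Y K W k)
  | none => G
  | some (Sum.inl _) => ⊤
  | some (Sum.inr _) => H

theorem leafFree_disjoint {K : Type} {T : K → Type} (S : ∀ k, SimpleGraph (T k)) (n : ℕ) :
    LeafFree (gluePiece (fun _ _ => (none : Option Unit)) S) ∅ n := by
  intro J _ hJ _
  by_cases h1 : ∃ k, J = {k}
  · exact Or.inl h1
  right
  obtain ⟨k, hk⟩ := hJ
  refine ⟨k, hk, by simp, ?_⟩
  refine ⟨Sum.inl (), Sum.inl (), fun w hw ⟨z, l, _, hlk, hz⟩ => ?_,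
    iff_of_false (SimpleGraph.irrefl _) fun ⟨_, _, _, h⟩ => h.ne rfl⟩
  obtain ⟨_, _, _, _, h, -⟩ := exists_of_support hlk.symm hw ⟨z, hz⟩
  cases h

/-- The vertex pair of a colour variable: an edge of `G`, an isolated edge, or an edge of a copy of
`H` in a clause. -/
def cspEdge (H : SimpleGraph W) (pa : A → VG × VG) :
    A ⊕ Y ⊕ (K × H.Dart) → (Unit ⊕ Σ k, CspVert VG Y K W k) × (Unit ⊕ Σ k, CspVert VG Y K W k)
  | Sum.inl a => (Sum.inr ⟨none, (pa a).1⟩, Sum.inr ⟨none, (pa a).2⟩)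
  | Sum.inr (Sum.inl y) => (Sum.inr ⟨some (Sum.inl y), false⟩, Sum.inr ⟨some (Sum.inl y), true⟩)
  | Sum.inr (Sum.inr (k, d)) =>
    (Sum.inr ⟨some (Sum.inr k), d.fst⟩, Sum.inr ⟨some (Sum.inr k), d.snd⟩)

/-- The relations between colours: those in `Rel`, and those that make an edge of a copy of `H`
coloured as the variable that occurs there in the clause `cl`. -/
inductive CspRel (H : SimpleGraph W) (cl : K → Sym2 W → Y) (Rel : A ⊕ Y → A ⊕ Y → Bool → Prop) :
    A ⊕ Y ⊕ (K × H.Dart) → A ⊕ Y ⊕ (K × H.Dart) → Bool → Prop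
  | rel (a b r) : Rel a b r → CspRel H cl Rel (Sum.map id Sum.inl a) (Sum.map id Sum.inl b) r
  | clause (k d) : CspRel H cl Rel (Sum.inr (Sum.inr (k, d)))
      (Sum.inr (Sum.inl (cl k d.edge))) true

theorem exists_csp {q : ℕ} [NeZero q] (hq : 2 ≤ q) [Fintype W] {H : SimpleGraph W}
    (hH : StrongConn H) [Finite VG] [Finite A] [Finite Y] [Finite K] (G : SimpleGraph VG)
    (pa : A → VG × VG) (hpa : ∀ a, G.Adj (pa a).1 (pa a).2) (cl : K → Sym2 W → Y)
    (Rel : A ⊕ Y → A ⊕ Y → Bool → Prop) :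
    ∃ (V : Type) (_ : Finite V) (F : SimpleGraph V) (ι : VG → V), ι.Injective ∧
      (∀ u v, G.Adj u v → F.Adj (ι u) (ι v)) ∧
      (∀ c : Sym2 V → Fin q, Good H F c → ∃ val : A ⊕ Y → Fin q,
        (∀ a, val (Sum.inl a) = c s(ι (pa a).1, ι (pa a).2)) ∧
        (∀ a b r, Rel a b r → (val a = val b ↔ r = true)) ∧
        ∀ k i, ∃ a b, H.Adj a b ∧ val (Sum.inr (cl k s(a, b))) ≠ i) ∧
      ∀ (D : Set (Sym2 VG)) (c : Sym2 VG → Fin q), Good H (G.deleteEdges D) c →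
        ∀ val : A ⊕ Y → Fin q,
        (∀ a, s((pa a).1, (pa a).2) ∉ D → val (Sum.inl a) = c s((pa a).1, (pa a).2)) →
        (∀ a b r, Rel a b r → (val a = val b ↔ r = true)) →
        (∀ k i, ∃ a b, H.Adj a b ∧ val (Sum.inr (cl k s(a, b))) ≠ i) →
        ∃ C : Sym2 V → Fin q, Good H (F.deleteEdges (Sym2.map ι '' D)) C := by
  classical
  let π : ∀ k, CspVert VG Y K W k → Option Unit := fun _ _ => none
  have hπ : PlacedInj π := fun k u v b h => by cases h
  let Z := glue π (cspPiece Y K G H)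
  have hfin : ∀ k, Finite (CspVert VG Y K W k) := by
    rintro (_ | _ | _)
    · exact ‹Finite VG›
    · exact inferInstanceAs (Finite Bool)
    · exact inferInstanceAs (Finite W)
  let N := A ⊕ Y ⊕ (K × H.Dart)
  have hN : Finite H.Dart := Finite.of_injective _ SimpleGraph.Dart.toProd_injective
  have hpl : ∀ a : N, Z.Adj (cspEdge H pa a).1 (cspEdge H pa a).2 := by
    rintro (a | y | ⟨k, d⟩)
    · exact hπ.glue_adj_of_adj (S := cspPiece Y K G H) (k := none) (hpa a)
    · exact hπ.glue_adj_of_adj (S := cspPiece Y K G H) (k := some (Sum.inl y))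
        (u := false) (v := true) (by simp [cspPiece])
    · exact hπ.glue_adj_of_adj (S := cspPiece Y K G H) (k := some (Sum.inr k)) d.adj
  let I := {x : N × N × Bool // CspRel H cl Rel x.1 x.2.1 x.2.2}
  obtain ⟨V, _, F, ι, hι, hadj, hR, hD⟩ := exists_constrained (q := q) hq hH Z
    (I := I) (fun x => cspEdge H pa x.1.1) (fun x => cspEdge H pa x.1.2.1)
    (fun x => x.1.2.2) (fun x => hpl _) fun x => hpl _
  have hinj : Function.Injective fun v : VG =>
      (Sum.inr ⟨none, v⟩ : Unit ⊕ Σ k, CspVert VG Y K W k) := hπ.injective none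
  refine ⟨V, ‹_›, F, fun v => ι (Sum.inr ⟨none, v⟩), hι.comp hinj,
    fun u v h => hadj _ _ (hπ.glue_adj_of_adj (S := cspPiece Y K G H) (k := none) h), ?_, ?_⟩
  · intro c hc
    have hR' : ∀ a b r, CspRel H cl Rel a b r →
        (c s(ι (cspEdge H pa a).1, ι (cspEdge H pa a).2) =
          c s(ι (cspEdge H pa b).1, ι (cspEdge H pa b).2) ↔ r = true) :=
      fun a b r h => hR c hc ⟨(a, b, r), h⟩
    refine ⟨fun a => c s(ι (cspEdge H pa (Sum.map id Sum.inl a)).1,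
      ι (cspEdge H pa (Sum.map id Sum.inl a)).2), fun a => rfl,
      fun a b r h => hR' _ _ _ (CspRel.rel a b r h), fun k i => ?_⟩
    by_contra! hcon
    have hc' := hc.comap (S := H) (j := fun w => ι (Sum.inr ⟨some (Sum.inr k), w⟩))
      (hι.comp (hπ.injective (some (Sum.inr k))))
      fun u v h => hadj _ _ (hπ.glue_adj_of_adj (S := cspPiece Y K G H) (k := some (Sum.inr k)) h)
    refine hc' ⟨i, Function.Embedding.refl _, fun a b hab => ⟨hab, ?_⟩⟩
    rw [← hcon a b hab]
    exact (hR' _ _ _ (CspRel.clause k ⟨(a, b), hab⟩)).2 rfl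
  · intro D c hc val hval hrel hcl
    let c' : ∀ k, Sym2 (CspVert VG Y K W k) → Fin q
      | none => c
      | some (Sum.inl y) => fun _ => val (Sum.inr y)
      | some (Sum.inr k) => fun e => val (Sum.inr (cl k e))
    let D' : Set (Sym2 (Unit ⊕ Σ k, CspVert VG Y K W k)) :=
      Sym2.map (fun v => Sum.inr ⟨none, v⟩) '' D
    obtain ⟨C, hC, hC'⟩ := hπ.exists_good (q := q) (S := cspPiece Y K G H) hH (J₀ := ∅) (by simp)
      (leafFree_disjoint _ _) D' c' (by
        rintro (_ | y | k)
        · refine hc.mono fun u v huv => ?_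
          have huv' := deleteEdges_adj.1 huv
          exact deleteEdges_adj.2 ⟨huv'.1, fun h => huv'.2 ⟨_, h, rfl⟩⟩
        · exact (good_bool hH fun _ => val (Sum.inr y)).mono (deleteEdges_le _)
        · exact (good_self (H := H) (c := fun e => val (Sum.inr (cl k e))) (hcl k)).mono
            (deleteEdges_le _)) (fun k l _ u v u' v' b b' h => by cases h)
    have hDmem : ∀ k u v, s((Sum.inr ⟨k, u⟩ : Unit ⊕ Σ k, CspVert VG Y K W k),
        Sum.inr ⟨k, v⟩) ∈ D' → k = none := by
      rintro k u v ⟨e, -, he⟩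
      induction e with
      | _ a b =>
        rw [Sym2.map_mk, Sym2.eq_iff] at he
        rcases he with ⟨he, -⟩ | ⟨he, -⟩
        · exact (Sigma.mk.inj (Sum.inr_injective he)).1.symm
        · exact (Sigma.mk.inj (Sum.inr_injective he)).1.symm
    let val' : N → Fin q := Sum.elim (fun a => val (Sum.inl a))
      (Sum.elim (fun y => val (Sum.inr y)) fun x => val (Sum.inr (cl x.1 x.2.edge)))
    have hval' : ∀ a : N, s((cspEdge H pa a).1, (cspEdge H pa a).2) ∉ D' →
        val' a = C s((cspEdge H pa a).1, (cspEdge H pa a).2) := by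
      rintro (a | y | ⟨k, d⟩) h
      · exact (hval a fun h' => h ⟨_, h', rfl⟩).trans (hC' none _ _ (hpa a) h).symm
      · exact (hC' (some (Sum.inl y)) false true (by simp [cspPiece]) h).symm
      · exact (hC' (some (Sum.inr k)) _ _ d.adj h).symm
    obtain ⟨C₂, hC₂⟩ := hD D' C hC (fun x => val' x.1.1) (fun x => val' x.1.2.1) (by
        rintro ⟨⟨a, b, r⟩, h⟩
        cases h with
        | rel a b r h =>
          have : ∀ a, val' (Sum.map id Sum.inl a) = val a := by
            rintro (_ | _) <;> rfl
          change val' (Sum.map id Sum.inl a) = val' (Sum.map id Sum.inl b) ↔ _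
          rw [this, this]
          exact hrel a b r h
        | clause k d => exact iff_of_true rfl rfl) (fun x => hval' _) fun x => hval' _
    refine ⟨C₂, ?_⟩
    have : Sym2.map (fun v => ι (Sum.inr ⟨none, v⟩)) '' D = Sym2.map ι '' D' := by
      rw [Set.image_image]
      refine Set.image_congr fun e _ => ?_
      rw [Sym2.map_map]
      rfl
    rw [this]
    exact hC₂

end Csp

/-- The auxiliary colour variables used to forbid a given colouring of `m` edges. -/
inductive GateVar (q m : ℕ)
  | p (j : Fin q)
  | r (k : Fin m)
  | s (k : Fin m)
  | t (k : Fin (m + 1))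

instance (q m : ℕ) : Finite (GateVar q m) :=
  Finite.of_surjective
    (Sum.elim (Sum.elim GateVar.p GateVar.r) (Sum.elim GateVar.s GateVar.t)) (by
      rintro (j | k | k | k)
      exacts [⟨Sum.inl (Sum.inl j), rfl⟩, ⟨Sum.inl (Sum.inr k), rfl⟩, ⟨Sum.inr (Sum.inl k), rfl⟩,
        ⟨Sum.inr (Sum.inr k), rfl⟩])

/-- The relations that force the variables `p j` to be the different colours, the `k`-th edge to
have colour `p (φ k)` and hence `r k = p z`, each `s k` and `t k` to be `p z` or `p o`, and
`t 0 = p z`, `t m = p o`, so that `r k = s k = t k = p z` for some `k`. Each edge occurs in two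
relations, one for each value of the Boolean. -/
inductive GateRel {q m : ℕ} (z o : Fin q) (φ : Fin m → Fin q) :
    (Bool × Fin m) ⊕ GateVar q m → (Bool × Fin m) ⊕ GateVar q m → Bool → Prop
  | pp (i j) : i ≠ j → GateRel z o φ (Sum.inr (.p i)) (Sum.inr (.p j)) false
  | ep (k) : GateRel z o φ (Sum.inl (false, k)) (Sum.inr (.p (φ k))) true
  | er (k) : GateRel z o φ (Sum.inl (true, k)) (Sum.inr (.r k)) (decide (φ k = z))
  | rp (k j) : j ≠ z → j ≠ (if φ k = z then o else φ k) →
      GateRel z o φ (Sum.inr (.r k)) (Sum.inr (.p j)) false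
  | sp (k j) : j ≠ z → j ≠ o → GateRel z o φ (Sum.inr (.s k)) (Sum.inr (.p j)) false
  | tp (k j) : j ≠ z → j ≠ o → GateRel z o φ (Sum.inr (.t k)) (Sum.inr (.p j)) false
  | st (k : Fin m) : GateRel z o φ (Sum.inr (.s k)) (Sum.inr (.t k.succ)) false
  | t_first : GateRel z o φ (Sum.inr (.t 0)) (Sum.inr (.p z)) true
  | t_last : GateRel z o φ (Sum.inr (.t (Fin.last m))) (Sum.inr (.p z)) false

section Gate

variable {q m : ℕ} {z o : Fin q} {φ : Fin m → Fin q} {val : (Bool × Fin m) ⊕ GateVar q m → Fin q}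

theorem GateRel.exists_eq (h : ∀ a b r, GateRel z o φ a b r → (val a = val b ↔ r = true))
    (he : ∀ k, val (Sum.inl (true, k)) = val (Sum.inl (false, k))) :
    ∃ k, val (Sum.inr (.r k)) = val (Sum.inr (.p z)) ∧
      val (Sum.inr (.s k)) = val (Sum.inr (.p z)) ∧
      val (Sum.inr (.t k.castSucc)) = val (Sum.inr (.p z)) := by
  by_contra! hcon
  have hp : Function.Injective fun j => val (Sum.inr (.p j)) := by
    intro i j hij
    by_contra hne
    exact Bool.false_ne_true ((h _ _ _ (.pp i j hne)).1 hij)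
  have hex : ∀ a (j₁ j₂ : Fin q), (∀ j, j ≠ j₁ → j ≠ j₂ → val a ≠ val (Sum.inr (.p j))) →
      val a = val (Sum.inr (.p j₁)) ∨ val a = val (Sum.inr (.p j₂)) := by
    intro a j₁ j₂ hne
    obtain ⟨j, hj⟩ := Finite.surjective_of_injective hp (val a)
    by_cases h1 : j = j₁
    · exact Or.inl (by rw [← hj, h1])
    by_cases h2 : j = j₂
    · exact Or.inr (by rw [← hj, h2])
    exact (hne j h1 h2 hj.symm).elim
  have hr : ∀ k, val (Sum.inr (.r k)) = val (Sum.inr (.p z)) := by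
    intro k
    have hep := (h _ _ _ (.ep k)).2 rfl
    have her := h _ _ _ (.er k)
    rw [he, hep, decide_eq_true_iff] at her
    by_cases hk : φ k = z
    · rw [← her.2 hk, hk]
    · refine (hex _ z (φ k) fun j h1 h2 h3 => ?_).resolve_right fun h4 => hk (her.1 h4.symm)
      exact Bool.false_ne_true ((h _ _ _ (.rp k j h1 (by rwa [if_neg hk]))).1 h3)
  have ht : ∀ k : Fin (m + 1), val (Sum.inr (.t k)) = val (Sum.inr (.p z)) := by
    intro k
    induction k using Fin.induction with
    | zero => exact (h _ _ _ .t_first).2 rfl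
    | succ k ih =>
      have hs : val (Sum.inr (.s k)) = val (Sum.inr (.p o)) :=
        (hex _ z o fun j h1 h2 h3 => Bool.false_ne_true
          ((h _ _ _ (.sp k j h1 h2)).1 h3)).resolve_left fun h4 => hcon k (hr k) h4 ih
      refine (hex _ z o fun j h1 h2 h3 => Bool.false_ne_true
          ((h _ _ _ (.tp k.succ j h1 h2)).1 h3)).resolve_right fun h4 => ?_
      exact Bool.false_ne_true ((h _ _ _ (.st k)).1 (hs.trans h4.symm))
  exact Bool.false_ne_true ((h _ _ _ .t_last).1 (ht _))

theorem GateRel.exists_val (hzo : z ≠ o) (φ : Fin m → Fin q) (k₀ : Fin m) :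
    ∃ val : (Bool × Fin m) ⊕ GateVar q m → Fin q,
      (∀ a b r, GateRel z o φ a b r → (val a = val b ↔ r = true)) ∧
      (∀ b k, k ≠ k₀ → val (Sum.inl (b, k)) = φ k) ∧
      ∀ k i, ¬ (val (Sum.inr (.r k)) = i ∧ val (Sum.inr (.s k)) = i ∧
        val (Sum.inr (.t k.castSucc)) = i) := by
  let val : (Bool × Fin m) ⊕ GateVar q m → Fin q
    | Sum.inl (b, k) => if b = true ∧ k = k₀ then (if φ k = z then o else z) else φ k
    | Sum.inr (.p j) => j
    | Sum.inr (.r k) => if k = k₀ then (if φ k = z then o else φ k) else z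
    | Sum.inr (.s k) => if k < k₀ then o else z
    | Sum.inr (.t k) => if k ≤ k₀.castSucc then z else o
  refine ⟨val, ?_, ?_, ?_⟩
  · intro a b r h
    cases h with
    | pp i j h => simpa [val] using h
    | ep k => simp [val]
    | er k =>
      simp only [val, true_and, decide_eq_true_iff]
      split_ifs <;> simp_all [eq_comm]
    | rp k j h1 h2 =>
      simp only [val]
      split_ifs <;> simp_all [eq_comm]
    | sp k j h1 h2 =>
      simp only [val]
      split_ifs <;> simp_all [eq_comm]
    | tp k j h1 h2 =>
      simp only [val]
      split_ifs <;> simp_all [eq_comm]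
    | st k =>
      have : k.succ ≤ k₀.castSucc ↔ k < k₀ := by
        rw [Fin.le_def, Fin.lt_def, Fin.val_succ, Fin.val_castSucc, Nat.succ_le_iff]
      simp only [val, this]
      split_ifs <;> simp_all [eq_comm]
    | t_first => simp [val]
    | t_last =>
      have : ¬ Fin.last m ≤ k₀.castSucc := not_le.2 (Fin.castSucc_lt_last k₀)
      simp [val, this, hzo.symm]
  · intro b k hk
    simp [val, hk]
  · rintro k i ⟨h1, h2, h3⟩
    simp only [val, Fin.castSucc_le_castSucc_iff] at h1 h2 h3
    rcases lt_trichotomy k k₀ with h | rfl | h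
    · simp_all [h.ne]
    · simp only [if_true, le_refl] at h1 h3
      split_ifs at h1 <;> simp_all
    · simp_all [h.ne', h.not_gt, h.not_ge]

end Gate

open Classical in
/-- Every finite graph without the Ramsey property embeds in a finite Ramsey graph in such a way
that all of its edges are critical. -/
theorem exists_isRamsey_critical {q : ℕ} [NeZero q] (hq : 2 ≤ q) {W : Type} [Fintype W]
    {H : SimpleGraph W} (hH : StrongConn H) {VG : Type} [Finite VG] {G : SimpleGraph VG}
    (hG : ¬ IsRamsey q G H) :
    ∃ (V : Type) (_ : Finite V) (F : SimpleGraph V) (ι : VG → V), ι.Injective ∧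
      IsRamsey q F H ∧ ∀ u v, G.Adj u v → F.Adj (ι u) (ι v) ∧
        ¬ IsRamsey q (F.deleteEdges {s(ι u, ι v)}) H := by
  obtain ⟨φ, hφ⟩ := not_isRamsey_iff.1 hG
  obtain ⟨z, o, hzo⟩ : ∃ z o : Fin q, z ≠ o :=
    ⟨⟨0, by omega⟩, ⟨1, by omega⟩, fun h => by simpa using congrArg Fin.val h⟩
  obtain ⟨m, ⟨en⟩⟩ := Finite.exists_equiv_fin G.edgeSet
  let pair : Fin m → VG × VG := fun k => (en.symm k).1.out
  have hpair : ∀ k, s((pair k).1, (pair k).2) = (en.symm k).1 := fun k => Quot.out_eq _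
  have hadj : ∀ k, G.Adj (pair k).1 (pair k).2 := by
    intro k
    rw [← mem_edgeSet, hpair]
    exact (en.symm k).2
  obtain ⟨a, b, c, d, hab, hac, hbd, hcb, hda⟩ := hH.exists_path
  let cl : Fin m → Sym2 W → GateVar q m := fun k e =>
    if e = s(a, b) then .r k else if e = s(a, c) then .s k else
      if e = s(b, d) then .t k.castSucc else .p z
  have h21 : s(a, c) ≠ s(a, b) := by
    simp [hcb, hab.ne]
  have h31 : s(b, d) ≠ s(a, b) := by
    simp [hda, hab.ne']
  have h32 : s(b, d) ≠ s(a, c) := by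
    simp [hab.ne', hda]
  obtain ⟨V, _, F, ι, hι, hF, hR, hD⟩ := exists_csp (q := q) hq hH G
    (fun x : Bool × Fin m => pair x.2) (fun x => hadj x.2) cl
    (GateRel z o fun k => φ s((pair k).1, (pair k).2))
  refine ⟨V, ‹_›, F, ι, hι, ?_, fun u v huv => ⟨hF u v huv, ?_⟩⟩
  · by_contra hnot
    obtain ⟨C, hC⟩ := not_isRamsey_iff.1 hnot
    obtain ⟨val, h1, h2, h3⟩ := hR C hC
    obtain ⟨k, hr, hs, ht⟩ := GateRel.exists_eq h2
      fun k => (h1 (true, k)).trans (h1 (false, k)).symm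
    obtain ⟨u, v, -, hne⟩ := h3 k (val (Sum.inr (.p z)))
    refine hne ?_
    simp only [cl]
    split_ifs
    exacts [hr, hs, ht, rfl]
  · let k₀ := en ⟨s(u, v), huv⟩
    obtain ⟨val, h1, h2, h3⟩ := GateRel.exists_val hzo (fun k => φ s((pair k).1, (pair k).2)) k₀
    have hk₀ : ∀ k, s((pair k).1, (pair k).2) ∉ ({s(u, v)} : Set (Sym2 VG)) → k ≠ k₀ := by
      rintro k hk rfl
      refine hk ?_
      rw [hpair]
      simp [k₀]
    obtain ⟨C, hC⟩ := hD {s(u, v)} φ (hφ.mono (deleteEdges_le _)) val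
      (fun x hx => h2 x.1 x.2 (hk₀ _ hx)) h1 (fun k i => by
        by_contra! hcon
        refine h3 k i ⟨?_, ?_, ?_⟩
        · simpa [cl] using hcon a b hab
        · simpa only [cl, if_neg h21, if_true] using hcon a c hac
        · simpa only [cl, if_neg h31, if_neg h32, if_true] using hcon b d hbd)
    rw [Set.image_singleton, Sym2.map_mk] at hC
    exact not_isRamsey_iff.2 ⟨C, hC⟩

theorem IsRamsey.of_injective {q : ℕ} {V V' W : Type} {H : SimpleGraph W} {S : SimpleGraph V'}
    {F : SimpleGraph V} (h : IsRamsey q S H) {j : V' → V} (hj : j.Injective)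
    (hS : ∀ u v, S.Adj u v → F.Adj (j u) (j v)) : IsRamsey q F H := by
  by_contra hF
  obtain ⟨c, hc⟩ := not_isRamsey_iff.1 hF
  exact not_isRamsey_iff.2 ⟨_, hc.comap hj hS⟩ h

theorem IsRamsey.exists_isRamseyMinimal {q : ℕ} {V W : Type} [Finite V] {H : SimpleGraph W}
    {G : SimpleGraph V} (h : IsRamsey q G H) :
    ∃ G' : G.Subgraph, IsRamseyMinimal q G'.coe H ∧
      ∀ G'' : G.Subgraph, G'' ≤ G' → IsRamsey q G''.coe H → G'' = G' := by
  obtain ⟨G', hG', hmin⟩ := (Set.toFinite {G' : G.Subgraph | IsRamsey q G'.coe H}).exists_minimal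
    ⟨⊤, h.of_injective (j := fun v => ⟨v, trivial⟩) (fun u v h => congrArg Subtype.val h)
      fun u v h => h⟩
  have hmin' : ∀ G'' : G.Subgraph, G'' ≤ G' → IsRamsey q G''.coe H → G'' = G' :=
    fun G'' hle hR => le_antisymm hle (hmin hR hle)
  refine ⟨G', ⟨hG', fun S hS hR => hS ?_⟩, hmin'⟩
  have hS' : G'.coeSubgraph S = G' := by
    refine hmin' _ (Subgraph.coeSubgraph_le S) (hR.of_injective
      (j := fun v => ⟨v.1.1, ⟨v.1, v.2, rfl⟩⟩)
      (fun u v h => Subtype.ext (Subtype.ext (Subtype.mk.inj h))) fun u v h => ?_)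
    exact Subgraph.coeSubgraph_adj .. |>.2 ⟨u.1.2, v.1.2, h⟩
  refine Subgraph.coeSubgraph_injective G' (hS'.trans ?_)
  ext <;> simp

/-- The graph `G` with a pendant edge at each vertex. -/
def addPendant {V : Type} (G : SimpleGraph V) : SimpleGraph (V × Bool) where
  Adj x y := (x.2 = false ∧ y.2 = false ∧ G.Adj x.1 y.1) ∨ (x.1 = y.1 ∧ x.2 ≠ y.2)
  symm := ⟨fun _ _ h => h.imp (fun h => ⟨h.2.1, h.1, h.2.2.symm⟩) fun h => ⟨h.1.symm, h.2.symm⟩⟩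
  loopless := ⟨fun _ h => h.elim (fun h => h.2.2.ne rfl) fun h => h.2 rfl⟩

theorem Good.addPendant {q : ℕ} {V W : Type} [Fintype W] {H : SimpleGraph W} (hH : StrongConn H)
    {G : SimpleGraph V} {c : Sym2 V → Fin q} (hc : Good H G c) :
    Good H (addPendant G) fun e => c (e.map Prod.fst) := by
  rintro ⟨i, f, hf⟩
  have h2 : ∀ a, (f a).2 = false := by
    intro a
    by_contra ha
    obtain ⟨b, hb⟩ := hH.exists_adj a
    obtain ⟨b', hne, hb'⟩ := hH.exists_adj_ne a b
    have hpen : ∀ b, H.Adj a b → f b = ((f a).1, false) := by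
      intro b hb
      rcases (hf a b hb).1 with h | h
      · exact (ha h.1).elim
      · refine Prod.ext h.1.symm ?_
        have := h.2
        simp only [Bool.not_eq_false] at ha
        rw [ha] at this
        simpa using this.symm
    exact hne (f.injective ((hpen b' hb').trans (hpen b hb).symm))
  refine hc ⟨i, ⟨fun a => (f a).1,
      fun a b h => f.injective (Prod.ext h ((h2 a).trans (h2 b).symm))⟩,
    fun a b hab => ⟨?_, (hf a b hab).2⟩⟩
  rcases (hf a b hab).1 with h | h
  · exact h.2.2
  · exact (h.2 ((h2 a).trans (h2 b).symm)).elim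

theorem isRamseyMinimal_of_subset {q : ℕ} (hq : 2 ≤ q) {VH VH' : Type} [Fintype VH]
    {H : SimpleGraph VH} (hH : StrongConn H) {H' : SimpleGraph VH'}
    (hsub : ∀ (V : Type) [Fintype V] (G : SimpleGraph V),
      IsRamseyMinimal q G H → IsRamseyMinimal q G H')
    {V : Type} [Finite V] {G : SimpleGraph V} (hG : IsRamseyMinimal q G H') :
    IsRamseyMinimal q G H := by
  classical
  have : NeZero q := ⟨by omega⟩
  have hsub' : ∀ {V : Type} [Finite V] {G : SimpleGraph V},
      IsRamseyMinimal q G H → IsRamseyMinimal q G H' := fun {V} _ G h => by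
    have := Fintype.ofFinite V
    exact hsub V G h
  by_cases hR : IsRamsey q G H
  · obtain ⟨G', hmin, hG'⟩ := hR.exists_isRamseyMinimal
    have htop : G' = ⊤ := by
      by_contra hne
      exact hG.2 G' hne (hsub' hmin).1
    subst htop
    exact ⟨hR, fun G'' hne hR' => hne (hG' G'' le_top hR')⟩
  obtain ⟨φ, hφ⟩ := not_isRamsey_iff.1 hR
  obtain ⟨VF, _, F, ι, hι, hF, hcrit⟩ := exists_isRamsey_critical hq hH
    (not_isRamsey_iff.2 ⟨_, hφ.addPendant hH⟩)
  obtain ⟨F', hF', -⟩ := hF.exists_isRamseyMinimal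
  have hadj : ∀ x y, (addPendant G).Adj x y → F'.Adj (ι x) (ι y) := by
    intro x y hxy
    by_contra hnot
    refine (hcrit x y hxy).2 (hF'.1.of_injective Subtype.val_injective fun u v huv => ?_)
    refine deleteEdges_adj.2 ⟨F'.adj_sub huv, fun h => hnot ?_⟩
    rcases Sym2.eq_iff.1 (Set.mem_singleton_iff.1 h) with ⟨h1, h2⟩ | ⟨h1, h2⟩
    · rw [← h1, ← h2]
      exact huv
    · rw [← h1, ← h2]
      exact huv.symm
  let j : V → F'.verts := fun v => ⟨ι (v, false), (hadj (v, false) (v, true)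
    (Or.inr ⟨rfl, Bool.false_ne_true⟩)).fst_mem⟩
  have hj : j.Injective := fun u v h => congrArg Prod.fst (hι (congrArg Subtype.val h))
  have hjadj : ∀ u v, G.Adj u v → F'.coe.Adj (j u) (j v) :=
    fun u v h => hadj _ _ (Or.inl ⟨rfl, rfl, h⟩)
  let S : F'.coe.Subgraph :=
    { verts := Set.range j
      Adj := (G.map j).Adj
      adj_sub := by
        intro a b h
        obtain ⟨-, u, v, huv, rfl, rfl⟩ := SimpleGraph.map_adj' .. |>.1 h
        exact hjadj u v huv
      edge_vert := by
        intro a b h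
        obtain ⟨-, u, -, -, rfl, -⟩ := SimpleGraph.map_adj' .. |>.1 h
        exact ⟨u, rfl⟩
      symm := (G.map j).symm }
  have hS : S = ⊤ := by
    by_contra hne
    refine (hsub' hF').2 S hne (hG.1.of_injective (j := fun v => ⟨j v, v, rfl⟩)
      (fun u v h => hj (congrArg Subtype.val h)) fun u v h => ?_)
    exact SimpleGraph.map_adj' .. |>.2 ⟨(hjadj u v h).ne, u, v, h, rfl, rfl⟩
  have hsurj : j.Surjective := fun a => by
    have : a ∈ S.verts := hS ▸ trivial
    exact this
  refine (hR (hF'.1.of_injective (Function.injective_surjInv hsurj) fun a b hab => ?_)).elim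
  have h : S.Adj a b := by
    rw [hS]
    exact hab
  obtain ⟨-, u, v, huv, rfl, rfl⟩ := SimpleGraph.map_adj' .. |>.1 h
  have hinv : ∀ u, Function.surjInv hsurj (j u) = u :=
    fun u => hj (Function.surjInv_eq hsurj _)
  rwa [hinv, hinv]

/-- If `H` is 3-connected or a triangle, `q ≥ 2`, and every graph that is
`q`-Ramsey-minimal for `H` is also `q`-Ramsey-minimal for `H'`, then the classes of
`q`-Ramsey-minimal graphs for `H` and for `H'` coincide. -/
theorem stmt2 {VH VH' : Type} [Fintype VH] [Fintype VH']
    (H : SimpleGraph VH) (hH : ThreeConnOrK3 H)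
    (q : ℕ) (hq : 2 ≤ q)
    (H' : SimpleGraph VH')
    (hsub : ∀ (V : Type) [Fintype V] (G : SimpleGraph V),
      IsRamseyMinimal q G H → IsRamseyMinimal q G H') :
    ∀ (V : Type) [Fintype V] (G : SimpleGraph V),
      IsRamseyMinimal q G H ↔ IsRamseyMinimal q G H' :=
  fun V _ G => ⟨hsub V G, isRamseyMinimal_of_subset hq hH.strongConn hsub⟩
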